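/- arXiv:2601.21710 — 4 statements merged into one kernel-verified Lean document; each statement's English description precedes it below -/
import Mathlib

section
/- Let c ∈ ℝ and let (p_n) be a sequence in [0,1] with n·p_n − log n → c. Then liminf_{n→∞} P(G_{n,p_n} ∈ D^n) ≥ e^{−2e^{−c}}(1 + 2e^{−c} + e^{−2c}), where G_{n,p_n} is a digraph drawn from the random digraph model G(n, p_n) and D^n is the set of structurally diagonalizable n-vertex digraphs. -/
open Finset Filter

/-- A matching in the bipartite representation of a digraph on `Fin n`:
a set of edges no two of which share a left endpoint or share a right endpoint. -/
def IsMatching (n : ℕ) (M : Finset (Fin n × Fin n)) : Prop :=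
  ∀ e ∈ M, ∀ f ∈ M, (e.1 = f.1 ∨ e.2 = f.2) → e = f

/-- `M` is a maximum matching of the bipartite representation of the digraph
with edge set `E`. -/
def IsMaxMatching (n : ℕ) (E M : Finset (Fin n × Fin n)) : Prop :=
  M ⊆ E ∧ IsMatching n M ∧ ∀ M' ⊆ E, IsMatching n M' → M'.card ≤ M.card

/-- The digraph `(V, M)` is a disjoint union of directed cycles and isolated
vertices: `M` is the graph of a permutation restricted to an invariant set `S`,
all vertices outside `S` being isolated. -/
def CyclesAndIsolated (n : ℕ) (M : Finset (Fin n × Fin n)) : Prop :=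
  ∃ σ : Equiv.Perm (Fin n), ∃ S : Finset (Fin n),
    (∀ u ∈ S, σ u ∈ S) ∧ M = S.image fun u => (u, σ u)

/-- A digraph is structurally diagonalizable if its bipartite representation has a
maximum matching `M` such that `(V, M)` is a disjoint union of directed cycles
and isolated vertices. -/
def StructurallyDiagonalizable (n : ℕ) (E : Finset (Fin n × Fin n)) : Prop :=
  ∃ M, IsMaxMatching n E M ∧ CyclesAndIsolated n M

/-- A Hamiltonian decomposition: a spanning subgraph that is a disjoint union of
directed cycles covering all `n` vertices, i.e. the functional graph of a
permutation contained in `E`. -/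
def HasHamiltonianDecomposition (n : ℕ) (E : Finset (Fin n × Fin n)) : Prop :=
  ∃ σ : Equiv.Perm (Fin n), ∀ u, (u, σ u) ∈ E

/-- A consistent matching of the bipartite representation of `E`: a matching whose
set of left endpoints equals its set of right endpoints. -/
def IsConsistentMatching (n : ℕ) (E M : Finset (Fin n × Fin n)) : Prop :=
  M ⊆ E ∧ IsMatching n M ∧ M.image Prod.fst = M.image Prod.snd

/-- Neighborhood, on the right side, of a set `I` of left vertices of `B(G)`. -/
def leftNbhd (n : ℕ) (E : Finset (Fin n × Fin n)) (I : Finset (Fin n)) :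
    Finset (Fin n) :=
  Finset.univ.filter fun v => ∃ u ∈ I, (u, v) ∈ E

/-- Neighborhood, on the left side, of a set `I` of right vertices of `B(G)`. -/
def rightNbhd (n : ℕ) (E : Finset (Fin n × Fin n)) (I : Finset (Fin n)) :
    Finset (Fin n) :=
  Finset.univ.filter fun u => ∃ v ∈ I, (u, v) ∈ E

/-- Membership in `F_k^n`: (1) some subset `I` of one side of `B(G)` has `|I| = k`
and `|N(I)| = k - 1`; (2) no subset `J` of either side with `|J| < k` satisfies
`|N(J)| = |J| - 1`. -/
def memF (n k : ℕ) (E : Finset (Fin n × Fin n)) : Prop :=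
  (∃ I : Finset (Fin n), I.card = k ∧
      ((leftNbhd n E I).card + 1 = k ∨ (rightNbhd n E I).card + 1 = k)) ∧
  ∀ J : Finset (Fin n), J.card < k →
      (leftNbhd n E J).card + 1 ≠ J.card ∧ (rightNbhd n E J).card + 1 ≠ J.card

/-- Membership in `L_k^n`: the bipartite representation of `E` admits a maximum
matching of size `n - k` that decomposes the digraph into disjoint cycles and
isolated vertices. -/
def memL (n k : ℕ) (E : Finset (Fin n × Fin n)) : Prop :=
  ∃ M, IsMaxMatching n E M ∧ M.card = n - k ∧ CyclesAndIsolated n M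

/-- The probability, under the random digraph model `G(n, p, q)` (each non-loop
edge present independently with probability `p`, each self-loop with
probability `q`), that the sampled digraph lies in the set `A`. -/
noncomputable def digraphProb (n : ℕ) (p q : ℝ)
    (A : Set (Finset (Fin n × Fin n))) : ℝ :=
  ∑ E : Finset (Fin n × Fin n),
    Set.indicator A (fun E =>
      (∏ e ∈ E, if e.1 = e.2 then q else p) *
      ∏ e ∈ Finset.univ \ E, if e.1 = e.2 then 1 - q else 1 - p) E

section BernoulliSubset

variable {α : Type*} [Fintype α] [DecidableEq α]

/-- Expectation of `F` at the random subset of `α` containing each element independently with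
probability `p`. -/
noncomputable def bernExp (p : ℝ) (F : Finset α → ℝ) : ℝ :=
  ∑ E : Finset α, p ^ #E * (1 - p) ^ #(univ \ E) * F E

/-- Probability that the random subset of `α` containing each element independently with
probability `p` lies in `S`. -/
noncomputable def bernProb (p : ℝ) (S : Set (Finset α)) : ℝ :=
  bernExp p (S.indicator 1)

/-- The sets containing `T` and avoiding `Z`. -/
def cylinder (Z T : Finset α) : Set (Finset α) := {E | Disjoint E Z ∧ T ⊆ E}

lemma bernExp_mono {p : ℝ} (hp : p ∈ Set.Icc (0 : ℝ) 1) {F G : Finset α → ℝ} (h : ∀ E, F E ≤ G E) :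
    bernExp p F ≤ bernExp p G := by
  refine sum_le_sum fun E _ => mul_le_mul_of_nonneg_left (h E) ?_
  have := hp.1
  have : 0 ≤ 1 - p := by linarith [hp.2]
  positivity

lemma bernExp_sum {ι : Type*} (p : ℝ) (s : Finset ι) (F : ι → Finset α → ℝ) :
    bernExp p (fun E => ∑ i ∈ s, F i E) = ∑ i ∈ s, bernExp p (F i) := by
  simp only [bernExp, mul_sum]
  exact sum_comm

lemma bernExp_const_mul (p c : ℝ) (F : Finset α → ℝ) :
    bernExp p (fun E => c * F E) = c * bernExp p F := by
  simp only [bernExp, mul_sum]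
  exact sum_congr rfl fun E _ => by ring

lemma bernExp_add (p : ℝ) (F G : Finset α → ℝ) :
    bernExp p (fun E => F E + G E) = bernExp p F + bernExp p G := by
  simp only [bernExp, mul_add, sum_add_distrib]

lemma bernExp_sub (p : ℝ) (F G : Finset α → ℝ) :
    bernExp p (fun E => F E - G E) = bernExp p F - bernExp p G := by
  simp only [bernExp, mul_sub, sum_sub_distrib]

lemma bernProb_cylinder (p : ℝ) {Z T : Finset α} (h : Disjoint Z T) :
    bernProb p (cylinder Z T) = (1 - p) ^ #Z * p ^ #T := by
  have key := Fintype.prod_add (fun a => if a ∈ Z then 0 else p) (fun a => if a ∈ T then 0 else 1 - p)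
  have hl : ∏ a, ((if a ∈ Z then 0 else p) + (if a ∈ T then 0 else 1 - p))
      = (1 - p) ^ #Z * p ^ #T := by
    have : ∀ a, ((if a ∈ Z then 0 else p) + (if a ∈ T then 0 else 1 - p))
        = (if a ∈ Z then 1 - p else 1) * (if a ∈ T then p else 1) := by
      intro a
      have : a ∈ Z → a ∉ T := fun hz => Finset.disjoint_left.1 h hz
      by_cases h1 : a ∈ Z <;> by_cases h2 : a ∈ T <;> simp_all
    simp only [this, prod_mul_distrib]
    simp
  rw [← hl, key]
  refine sum_congr rfl fun E _ => ?_
  by_cases h1 : Disjoint E Z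
  · by_cases h2 : T ⊆ E
    · rw [Set.indicator_of_mem (show E ∈ cylinder Z T from ⟨h1, h2⟩)]
      have e1 : ∏ a ∈ E, (if a ∈ Z then 0 else p) = p ^ #E := by
        rw [prod_congr rfl fun a ha => if_neg (disjoint_left.1 h1 ha), prod_const]
      have e2 : ∏ a ∈ Eᶜ, (if a ∈ T then 0 else 1 - p) = (1 - p) ^ #(univ \ E) := by
        rw [prod_congr rfl fun a ha => if_neg fun h => mem_compl.1 ha (h2 h), prod_const,
          compl_eq_univ_sdiff]
      rw [e1, e2]; simp
    · rw [Set.indicator_of_notMem fun h => h2 h.2]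
      obtain ⟨a, ha, hE⟩ := not_subset.1 h2
      have h0 : ∏ a ∈ Eᶜ, (if a ∈ T then 0 else 1 - p) = 0 :=
        prod_eq_zero (mem_compl.2 hE) (if_pos ha)
      rw [h0]; simp
  · rw [Set.indicator_of_notMem fun h => h1 h.1]
    obtain ⟨a, ha, hE⟩ := not_disjoint_iff.1 h1
    have h0 : ∏ a ∈ E, (if a ∈ Z then 0 else p) = 0 := prod_eq_zero ha (if_pos hE)
    rw [h0]; simp

lemma bernProb_univ (p : ℝ) : bernProb p (Set.univ : Set (Finset α)) = 1 := by
  have := bernProb_cylinder p (disjoint_empty_left (∅ : Finset α))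
  simpa [cylinder] using this

lemma bernProb_nonneg {p : ℝ} (hp : p ∈ Set.Icc (0 : ℝ) 1) (S : Set (Finset α)) :
    0 ≤ bernProb p S := by
  have := bernExp_mono hp (F := fun _ => 0) (G := S.indicator 1)
    fun E => Set.indicator_nonneg (by simp) E
  simpa [bernProb, bernExp] using this

lemma bernProb_mono {p : ℝ} (hp : p ∈ Set.Icc (0 : ℝ) 1) {S T : Set (Finset α)} (h : S ⊆ T) :
    bernProb p S ≤ bernProb p T :=
  bernExp_mono hp fun E => Set.indicator_le_indicator_of_subset h (by simp) E

lemma bernProb_union_le {p : ℝ} (hp : p ∈ Set.Icc (0 : ℝ) 1) (S T : Set (Finset α)) :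
    bernProb p (S ∪ T) ≤ bernProb p S + bernProb p T := by
  rw [bernProb, bernProb, bernProb, ← bernExp_add]
  refine bernExp_mono hp fun E => ?_
  by_cases h1 : E ∈ S <;> by_cases h2 : E ∈ T <;> simp [h1, h2]

lemma bernProb_le_sum {ι : Type*} {p : ℝ} (hp : p ∈ Set.Icc (0 : ℝ) 1) (s : Finset ι)
    (S : Set (Finset α)) (T : ι → Set (Finset α)) (h : ∀ E ∈ S, ∃ i ∈ s, E ∈ T i) :
    bernProb p S ≤ ∑ i ∈ s, bernProb p (T i) := by
  simp only [bernProb]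
  rw [← bernExp_sum]
  refine bernExp_mono hp fun E => ?_
  have hnn : ∀ i ∈ s, 0 ≤ (T i).indicator (1 : Finset α → ℝ) E :=
    fun i _ => Set.indicator_nonneg (by simp) E
  by_cases hE : E ∈ S
  · obtain ⟨i, hi, hT⟩ := h E hE
    rw [Set.indicator_of_mem hE]
    calc (1 : Finset α → ℝ) E = (T i).indicator 1 E := (Set.indicator_of_mem hT _).symm
      _ ≤ _ := single_le_sum hnn hi
  · rw [Set.indicator_of_notMem hE]
    exact sum_nonneg hnn

lemma bernProb_preimage_map (p : ℝ) (e : α ≃ α) (S : Set (Finset α)) :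
    bernProb p {E | E.map e.toEmbedding ∈ S} = bernProb p S := by
  refine Fintype.sum_equiv (Equiv.finsetCongr e) _ _ fun E => ?_
  have hc : #(univ \ E.map e.toEmbedding) = #(univ \ E) := by
    rw [card_univ_sdiff, card_univ_sdiff, card_map]
  simp only [Equiv.finsetCongr_apply, card_map, hc]
  rfl

end BernoulliSubset

lemma digraphProb_eq_bernProb (n : ℕ) (p : ℝ) (A : Set (Finset (Fin n × Fin n))) :
    digraphProb n p p A = bernProb p A := by
  refine sum_congr rfl fun E _ => ?_
  by_cases h : E ∈ A <;> simp [h]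

lemma bernProb_disjoint_card_inter_le {α : Type*} [Fintype α] [DecidableEq α] {p : ℝ}
    (hp : p ∈ Set.Icc (0 : ℝ) 1) {Z N : Finset α} (h : Disjoint Z N) (k : ℕ) :
    bernProb p {E | Disjoint E Z ∧ k ≤ #(E ∩ N)}
      ≤ (#N).choose k * ((1 - p) ^ #Z * p ^ k) := by
  have h1 := bernProb_le_sum hp (powersetCard k N) {E | Disjoint E Z ∧ k ≤ #(E ∩ N)}
    (fun T => cylinder Z T) (by
      rintro E ⟨hE, hk⟩
      obtain ⟨T, hT, hc⟩ := exists_subset_card_eq hk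
      exact ⟨T, mem_powersetCard.2 ⟨hT.trans inter_subset_right, hc⟩, hE,
        hT.trans inter_subset_left⟩)
  refine h1.trans_eq ?_
  have h2 : ∀ T ∈ powersetCard k N, bernProb p (cylinder Z T) = (1 - p) ^ #Z * p ^ k := by
    intro T hT
    obtain ⟨hT, hc⟩ := mem_powersetCard.1 hT
    rw [bernProb_cylinder p (h.mono_right hT), hc]
  rw [sum_congr rfl h2, sum_const, card_powersetCard, nsmul_eq_mul]

section HallViolators

variable {α : Type*}

open Classical in
/-- The neighbourhood in `W` of the set `I` for the relation `R`. -/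
noncomputable def nbhdIn (R : α → α → Prop) (W I : Finset α) : Finset α :=
  {w ∈ W | ∃ i ∈ I, R i w}

/-- `I ⊆ W` has fewer than `#I` neighbours in `W`. -/
def IsHallViolator (R : α → α → Prop) (W I : Finset α) : Prop :=
  I ⊆ W ∧ #(nbhdIn R W I) < #I

lemma exists_isHallViolator (R : α → α → Prop) (W : Finset α)
    (h : ¬ ∃ f : W → W, Function.Injective f ∧ ∀ x : W, R x (f x)) :
    ∃ I, IsHallViolator R W I := by
  classical
  by_contra! hno
  apply h
  rw [← Fintype.all_card_le_filter_rel_iff_exists_injective (fun x y : W => R x y)]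
  intro A
  have h1 := hno (A.map (Function.Embedding.subtype _))
  rw [IsHallViolator, not_and, not_lt, card_map] at h1
  refine (h1 ?_).trans ?_
  · intro x hx
    simp only [Finset.mem_map, Function.Embedding.subtype_apply] at hx
    obtain ⟨y, -, rfl⟩ := hx
    exact y.2
  · rw [← card_map (Function.Embedding.subtype (· ∈ W))]
    refine card_le_card fun x hx => ?_
    simp only [nbhdIn, mem_filter, Finset.mem_map, Function.Embedding.subtype_apply] at hx ⊢
    obtain ⟨hxW, i, ⟨y, hy, rfl⟩, hR⟩ := hx
    exact ⟨⟨x, hxW⟩, ⟨mem_univ _, y, hy, hR⟩, rfl⟩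

variable [DecidableEq α]

lemma IsHallViolator.compl {R : α → α → Prop} {W I : Finset α} (h : IsHallViolator R W I) :
    IsHallViolator (fun x y => R y x) W (W \ nbhdIn R W I) := by
  classical
  refine ⟨sdiff_subset, ?_⟩
  have hsub : nbhdIn (fun x y => R y x) W (W \ nbhdIn R W I) ⊆ W \ I := by
    intro x hx
    simp only [nbhdIn, mem_filter, Finset.mem_sdiff, not_and, not_exists] at hx ⊢
    obtain ⟨hxW, i, ⟨hiW, hi⟩, hR⟩ := hx
    exact ⟨hxW, fun hxI => hi hiW x hxI hR⟩
  have h1 := card_le_card hsub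
  have h2 : nbhdIn R W I ⊆ W := filter_subset _ _
  rw [card_sdiff_of_subset h.1] at h1
  rw [card_sdiff_of_subset h2]
  have h3 := card_le_card h.1
  have h4 := h.2
  omega

open Classical in
/-- `I` has deficiency exactly one in `W`, witnessed by its neighbourhood `J`, and spans at least
`2 * #J` pairs with `J`. -/
def IsTightViolator (R : α → α → Prop) (W I J : Finset α) : Prop :=
  I ⊆ W ∧ J ⊆ W ∧ #J + 1 = #I ∧ 2 * #I ≤ #W + 1 ∧ (∀ i ∈ I, ∀ w ∈ W \ J, ¬ R i w) ∧
    2 * #J ≤ #{x ∈ I ×ˢ J | R x.1 x.2}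

lemma IsHallViolator.isTightViolator {R : α → α → Prop} {W I : Finset α}
    (h : IsHallViolator R W I) (hmin : ∀ I', IsHallViolator R W I' → #I ≤ #I')
    (hmin' : ∀ I', IsHallViolator (fun x y => R y x) W I' → #I ≤ #I') :
    IsTightViolator R W I (nbhdIn R W I) := by
  classical
  have hmono : ∀ I' ⊆ I, nbhdIn R W I' ⊆ nbhdIn R W I := by
    intro I' hI' x hx
    simp only [nbhdIn, mem_filter] at hx ⊢
    exact ⟨hx.1, hx.2.imp fun i hi => ⟨hI' hi.1, hi.2⟩⟩
  have herase : ∀ i ∈ I, #I ≤ #(nbhdIn R W (I.erase i)) + 1 := by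
    intro i hi
    by_contra! hlt
    have hc := card_erase_of_mem hi
    have := hmin (I.erase i) ⟨(erase_subset _ _).trans h.1, by omega⟩
    omega
  have hpos : 0 < #I := by have := h.2; omega
  have hcard : #(nbhdIn R W I) + 1 = #I := by
    obtain ⟨i, hi⟩ := card_pos.1 hpos
    have h1 := card_le_card (hmono _ (erase_subset i I))
    have h2 := herase i hi
    have h3 := h.2
    omega
  have hsub : nbhdIn R W I ⊆ W := filter_subset _ _
  refine ⟨h.1, hsub, hcard, ?_, ?_, ?_⟩
  · have h1 := hmin' _ h.compl
    rw [card_sdiff_of_subset hsub] at h1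
    have h2 := card_le_card hsub
    omega
  · intro i hi w hw hR
    rw [Finset.mem_sdiff] at hw
    exact hw.2 (mem_filter.2 ⟨hw.1, i, hi, hR⟩)
  · have hdeg : ∀ j ∈ nbhdIn R W I, 2 ≤ #{x ∈ {x ∈ I ×ˢ nbhdIn R W I | R x.1 x.2} | x.2 = j} := by
      intro j hj
      by_contra! hlt
      obtain ⟨hjW, i, hi, hR⟩ := mem_filter.1 hj
      have hmem : ∀ i' ∈ I, R i' j →
          (i', j) ∈ {x ∈ {x ∈ I ×ˢ nbhdIn R W I | R x.1 x.2} | x.2 = j} := by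
        intro i' hi' hR'
        simp [hi', hR', hj]
      have huniq : ∀ i' ∈ I, R i' j → i' = i := by
        intro i' hi' hR'
        have := card_le_one.1 (Nat.lt_succ_iff.1 hlt) _ (hmem i' hi' hR') _ (hmem i hi hR)
        exact congrArg Prod.fst this
      have hss : nbhdIn R W (I.erase i) ⊆ (nbhdIn R W I).erase j := by
        intro x hx
        refine mem_erase.2 ⟨?_, hmono _ (erase_subset i I) hx⟩
        rintro rfl
        obtain ⟨-, i', hi', hR'⟩ := mem_filter.1 hx
        exact (mem_erase.1 hi').1 (huniq i' (mem_erase.1 hi').2 hR')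
      have h1 := card_le_card hss
      have h2 := herase i hi
      have h3 := card_pos.2 ⟨j, hj⟩
      rw [card_erase_of_mem hj] at h1
      omega
    have hmaps : Set.MapsTo Prod.snd
        (({x ∈ I ×ˢ nbhdIn R W I | R x.1 x.2} : Finset (α × α)) : Set (α × α))
        (nbhdIn R W I : Set α) := by
      intro x hx
      simp only [coe_filter, mem_product, Set.mem_ofPred_eq] at hx
      exact hx.1.2
    rw [card_eq_sum_card_fiberwise hmaps]
    calc 2 * #(nbhdIn R W I) = ∑ _j ∈ nbhdIn R W I, 2 := by simp [mul_comm]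
      _ ≤ _ := sum_le_sum hdeg

lemma exists_isTightViolator (R : α → α → Prop) (W : Finset α)
    (h : ¬ ∃ f : W → W, Function.Injective f ∧ ∀ x : W, R x (f x)) :
    ∃ I J, IsTightViolator R W I J ∨ IsTightViolator (fun x y => R y x) W I J := by
  classical
  obtain ⟨I₀, hI₀⟩ := exists_isHallViolator R W h
  have hex : ∃ m I, #I = m ∧ (IsHallViolator R W I ∨ IsHallViolator (fun x y => R y x) W I) :=
    ⟨_, I₀, rfl, Or.inl hI₀⟩
  obtain ⟨I, hI, hv⟩ := Nat.find_spec hex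
  have hle : ∀ I', (IsHallViolator R W I' ∨ IsHallViolator (fun x y => R y x) W I') → #I ≤ #I' :=
    fun I' h' => hI ▸ Nat.find_min' hex ⟨I', rfl, h'⟩
  rcases hv with hv | hv
  · exact ⟨I, _, Or.inl (hv.isTightViolator (fun I' h' => hle I' (Or.inl h'))
      fun I' h' => hle I' (Or.inr h'))⟩
  · exact ⟨I, _, Or.inr (hv.isTightViolator (fun I' h' => hle I' (Or.inr h'))
      fun I' h' => hle I' (Or.inl h'))⟩

end HallViolators

section Structure

variable {n : ℕ}

/-- The exchange of the two coordinates of an edge. -/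
abbrev edgeSwap (n : ℕ) : (Fin n × Fin n) ≃ (Fin n × Fin n) := Equiv.prodComm _ _

lemma mem_map_edgeSwap {E : Finset (Fin n × Fin n)} {u v : Fin n} :
    (u, v) ∈ E.map (edgeSwap n).toEmbedding ↔ (v, u) ∈ E := by
  simp

lemma map_edgeSwap_map_edgeSwap (E : Finset (Fin n × Fin n)) :
    (E.map (edgeSwap n).toEmbedding).map (edgeSwap n).toEmbedding = E := by
  ext ⟨u, v⟩
  rw [mem_map_edgeSwap, mem_map_edgeSwap]

lemma IsMatching.map_edgeSwap {M : Finset (Fin n × Fin n)} (h : IsMatching n M) :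
    IsMatching n (M.map (edgeSwap n).toEmbedding) := by
  rintro ⟨a, b⟩ he ⟨a', b'⟩ hf hor
  rw [mem_map_edgeSwap] at he hf
  have := h _ he _ hf hor.symm
  simp only [Prod.mk.injEq] at this ⊢
  exact this.symm

lemma StructurallyDiagonalizable.map_edgeSwap {E : Finset (Fin n × Fin n)}
    (h : StructurallyDiagonalizable n E) :
    StructurallyDiagonalizable n (E.map (edgeSwap n).toEmbedding) := by
  obtain ⟨M, ⟨hME, hM, hmax⟩, σ, S, hS, rfl⟩ := h
  refine ⟨_, ⟨map_subset_map.2 hME, hM.map_edgeSwap, ?_⟩, σ⁻¹, S, ?_, ?_⟩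
  · intro M' hM' hm
    have h1 := hmax (M'.map (edgeSwap n).toEmbedding) ?_ hm.map_edgeSwap
    · rwa [card_map] at h1 ⊢
    · rw [← map_edgeSwap_map_edgeSwap E]
      exact map_subset_map.2 hM'
  · intro u hu
    have himg : S.image σ = S :=
      eq_of_subset_of_card_le (image_subset_iff.2 hS)
        (card_image_of_injective S σ.injective).ge
    rw [← himg] at hu
    obtain ⟨w, hw, rfl⟩ := mem_image.1 hu
    simpa using hw
  · ext ⟨u, v⟩
    rw [mem_map_edgeSwap]
    simp only [mem_image, Prod.mk.injEq]
    constructor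
    · rintro ⟨w, hw, rfl, rfl⟩
      exact ⟨σ w, hS w hw, rfl, by simp⟩
    · rintro ⟨w, hw, rfl, rfl⟩
      refine ⟨σ⁻¹ w, ?_, rfl, by simp⟩
      have himg : S.image σ = S :=
        eq_of_subset_of_card_le (image_subset_iff.2 hS)
          (card_image_of_injective S σ.injective).ge
      rw [← himg] at hw
      obtain ⟨w', hw', rfl⟩ := mem_image.1 hw
      simpa using hw'

lemma structurallyDiagonalizable_of_injective {E : Finset (Fin n × Fin n)} {W : Finset (Fin n)}
    (hW : ∀ u ∉ W, ∀ v, (u, v) ∉ E) (f : W → W) (hf : Function.Injective f)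
    (hE : ∀ x : W, ((x : Fin n), (f x : Fin n)) ∈ E) : StructurallyDiagonalizable n E := by
  let τ : Equiv.Perm W := Equiv.ofBijective f (Finite.injective_iff_bijective.1 hf)
  let σ : Equiv.Perm (Fin n) := Equiv.Perm.ofSubtype τ
  have hσ : ∀ u (hu : u ∈ W), σ u = f ⟨u, hu⟩ := fun u hu =>
    Equiv.Perm.ofSubtype_apply_of_mem τ hu
  refine ⟨W.image fun u => (u, σ u), ⟨?_, ?_, ?_⟩, σ, W, ?_, rfl⟩
  · intro e he
    obtain ⟨u, hu, rfl⟩ := mem_image.1 he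
    rw [hσ u hu]
    exact hE ⟨u, hu⟩
  · intro e he e' he' hor
    obtain ⟨u, -, rfl⟩ := mem_image.1 he
    obtain ⟨u', -, rfl⟩ := mem_image.1 he'
    have : u = u' := hor.elim id fun h => σ.injective h
    rw [this]
  · intro M' hM' hm
    rw [card_image_of_injective _ fun u v h => (Prod.mk.inj h).1]
    refine card_le_card_of_injOn Prod.fst ?_ ?_
    · intro e he
      by_contra hne
      exact hW e.1 hne e.2 (hM' he)
    · intro e he e' he' h
      exact hm e he e' he' (Or.inl h)
  · intro u hu
    rw [hσ u hu]
    exact (f ⟨u, hu⟩).2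

/-- The digraphs without a vertex of in-degree zero that are not structurally diagonalizable. -/
def nondiagonalizableOfNoSource (n : ℕ) : Set (Finset (Fin n × Fin n)) :=
  {E | (∀ v, ∃ u, (u, v) ∈ E) ∧ ¬ StructurallyDiagonalizable n E}

/-- The vertices of out-degree zero. -/
def sinks (E : Finset (Fin n × Fin n)) : Finset (Fin n) := {u | ∀ v, (u, v) ∉ E}

/-- The pairs that avoid `E` because `A` consists of sinks and `I` has no out-neighbours in
`Aᶜ \ J`. -/
def forbiddenOut (A I J : Finset (Fin n)) : Finset (Fin n × Fin n) :=
  A ×ˢ univ ∪ I ×ˢ (Aᶜ \ J)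

/-- The pairs that avoid `E` because `A` consists of sinks and `I` has no in-neighbours in
`Aᶜ \ J`. -/
def forbiddenIn (A I J : Finset (Fin n)) : Finset (Fin n × Fin n) :=
  A ×ˢ univ ∪ (Aᶜ \ J) ×ˢ I

lemma disjoint_product_sinks {A : Finset (Fin n)} {E : Finset (Fin n × Fin n)}
    (hA : sinks E = A) : Disjoint E (A ×ˢ univ) := by
  rw [Finset.disjoint_left]
  rintro ⟨u, v⟩ hE hm
  have hu : u ∈ sinks E := hA ▸ (mem_product.1 hm).1
  exact (mem_filter.1 hu).2 v hE

lemma exists_obstruction {A : Finset (Fin n)} {E : Finset (Fin n × Fin n)}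
    (hE : E ∈ nondiagonalizableOfNoSource n) (hA : sinks E = A) :
    (∃ u ∈ Aᶜ, ∃ a ∈ A, E ∈ cylinder (A ×ˢ univ ∪ {u} ×ˢ Aᶜ) {(u, a)}) ∨
    ∃ I ⊆ Aᶜ, ∃ J ⊆ Aᶜ, #J + 1 = #I ∧ 2 ≤ #I ∧ 2 * #I ≤ #Aᶜ + 1 ∧
      ((Disjoint E (forbiddenOut A I J) ∧ 2 * #J ≤ #(E ∩ I ×ˢ J)) ∨
        (Disjoint E (forbiddenIn A I J) ∧ 2 * #J ≤ #(E ∩ J ×ˢ I))) := by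
  classical
  obtain ⟨hcol, hnsd⟩ := hE
  have hdis := disjoint_product_sinks hA
  have hrow : ∀ u ∉ Aᶜ, ∀ v, (u, v) ∉ E := by
    intro u hu v hE
    rw [mem_compl, not_not] at hu
    exact Finset.disjoint_left.1 hdis hE (mem_product.2 ⟨hu, mem_univ _⟩)
  obtain ⟨I, J, h⟩ := exists_isTightViolator (fun x y => (x, y) ∈ E) Aᶜ (by
    rintro ⟨f, hf, hfE⟩
    exact hnsd (structurallyDiagonalizable_of_injective hrow f hf hfE))
  rcases h with ⟨hI, hJ, hc, hm, hz, he⟩ | ⟨hI, hJ, hc, hm, hz, he⟩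
  · have hfd : Disjoint E (I ×ˢ (Aᶜ \ J)) := by
      rw [Finset.disjoint_left]
      rintro ⟨u, v⟩ hE hmem
      rw [mem_product] at hmem
      exact hz u hmem.1 v hmem.2 hE
    by_cases h2 : 2 ≤ #I
    · refine Or.inr ⟨I, hI, J, hJ, hc, h2, hm, Or.inl ⟨disjoint_union_right.2 ⟨hdis, hfd⟩, ?_⟩⟩
      refine he.trans_eq (congrArg card ?_)
      ext ⟨u, v⟩
      simp [and_comm]
    · left
      obtain rfl : J = ∅ := card_eq_zero.1 (by omega)
      obtain ⟨u, rfl⟩ := card_eq_one.1 (show #I = 1 by simpa using hc.symm)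
      have hu : u ∈ Aᶜ := hI (mem_singleton_self u)
      have hus : u ∉ sinks E := by rw [hA]; exact mem_compl.1 hu
      obtain ⟨a, ha⟩ : ∃ a, (u, a) ∈ E := by simpa [sinks] using hus
      refine ⟨u, hu, a, ?_, disjoint_union_right.2 ⟨hdis, by simpa using hfd⟩,
        singleton_subset_iff.2 ha⟩
      by_contra haA
      exact hz u (mem_singleton_self u) a (by simpa using haA) ha
  · have hfd : Disjoint E ((Aᶜ \ J) ×ˢ I) := by
      rw [Finset.disjoint_left]
      rintro ⟨u, v⟩ hE hmem
      rw [mem_product] at hmem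
      exact hz v hmem.2 u hmem.1 hE
    by_cases h2 : 2 ≤ #I
    · refine Or.inr ⟨I, hI, J, hJ, hc, h2, hm, Or.inr ⟨disjoint_union_right.2 ⟨hdis, hfd⟩, ?_⟩⟩
      rw [← card_map (edgeSwap n).toEmbedding] at he
      refine he.trans_eq (congrArg card ?_)
      ext ⟨u, v⟩
      rw [mem_map_edgeSwap]
      simp only [mem_filter, mem_product, mem_inter]
      tauto
    · exfalso
      obtain rfl : J = ∅ := card_eq_zero.1 (by omega)
      obtain ⟨v, rfl⟩ := card_eq_one.1 (show #I = 1 by simpa using hc.symm)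
      obtain ⟨u, hu⟩ := hcol v
      by_cases huA : u ∈ Aᶜ
      · exact hz v (mem_singleton_self v) u (by simpa using huA) hu
      · exact hrow u huA v hu

lemma card_forbiddenOut {A I J : Finset (Fin n)} (hI : I ⊆ Aᶜ) (hJ : J ⊆ Aᶜ) :
    #(forbiddenOut A I J) = n * #A + #I * (n - #A - #J) := by
  rw [forbiddenOut, card_union_of_disjoint, card_product, card_product, card_univ,
    card_sdiff_of_subset hJ, card_compl, Fintype.card_fin, mul_comm]
  rw [Finset.disjoint_left]
  rintro ⟨u, v⟩ h1 h2
  exact mem_compl.1 (hI (mem_product.1 h2).1) (mem_product.1 h1).1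

lemma card_forbiddenIn {A I J : Finset (Fin n)} (hJ : J ⊆ Aᶜ) :
    #(forbiddenIn A I J) = n * #A + #I * (n - #A - #J) := by
  rw [forbiddenIn, card_union_of_disjoint, card_product, card_product, card_univ,
    card_sdiff_of_subset hJ, card_compl, Fintype.card_fin, mul_comm, mul_comm (#I)]
  rw [Finset.disjoint_left]
  rintro ⟨u, v⟩ h1 h2
  exact mem_compl.1 (Finset.mem_sdiff.1 (mem_product.1 h2).1).1 (mem_product.1 h1).1

lemma disjoint_forbiddenOut {A I J : Finset (Fin n)} (hI : I ⊆ Aᶜ) :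
    Disjoint (forbiddenOut A I J) (I ×ˢ J) := by
  rw [Finset.disjoint_left]
  rintro ⟨u, v⟩ h1 h2
  simp only [forbiddenOut, mem_union, mem_product, Finset.mem_sdiff] at h1 h2
  have := mem_compl.1 (hI h2.1)
  tauto

lemma disjoint_forbiddenIn {A I J : Finset (Fin n)} (hJ : J ⊆ Aᶜ) :
    Disjoint (forbiddenIn A I J) (J ×ˢ I) := by
  rw [Finset.disjoint_left]
  rintro ⟨u, v⟩ h1 h2
  simp only [forbiddenIn, mem_union, mem_product, Finset.mem_sdiff] at h1 h2
  have := mem_compl.1 (hJ h2.1)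
  tauto

/-- Bound for the expected number of violators of size `s` among `m` vertices, on one side. -/
noncomputable def violatorTerm (p : ℝ) (m s : ℕ) : ℝ :=
  m.choose s * m.choose (s - 1) *
    ((s * (s - 1)).choose (2 * (s - 1)) * ((1 - p) ^ (s * (m - (s - 1))) * p ^ (2 * (s - 1))))

/-- Bound for the conditional probability of an obstruction, given that `k` prescribed vertices
are sinks. -/
noncomputable def obstructionBound (p : ℝ) (n k : ℕ) : ℝ :=
  n * k * ((1 - p) ^ (n - k) * p) +
    2 * ∑ s ∈ Icc 2 ((n - k + 1) / 2), violatorTerm p (n - k) s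

lemma bernProb_singleton_obstruction_le {p : ℝ} (hp : p ∈ Set.Icc (0 : ℝ) 1)
    (A : Finset (Fin n)) :
    bernProb p {E | ∃ u ∈ Aᶜ, ∃ a ∈ A, E ∈ cylinder (A ×ˢ univ ∪ {u} ×ˢ Aᶜ) {(u, a)}}
      ≤ (1 - p) ^ (n * #A) * (n * #A * ((1 - p) ^ (n - #A) * p)) := by
  have hq : 0 ≤ 1 - p := sub_nonneg.2 hp.2
  have hp0 := hp.1
  refine (bernProb_le_sum hp (Aᶜ ×ˢ A) _
    (fun x => cylinder (A ×ˢ univ ∪ {x.1} ×ˢ Aᶜ) {(x.1, x.2)}) ?_).trans ?_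
  · rintro E ⟨u, hu, a, ha, h⟩
    exact ⟨(u, a), mem_product.2 ⟨hu, ha⟩, h⟩
  · have h1 : ∀ x ∈ Aᶜ ×ˢ A, bernProb p (cylinder (A ×ˢ univ ∪ {x.1} ×ˢ Aᶜ) {(x.1, x.2)})
        = (1 - p) ^ (n * #A) * ((1 - p) ^ (n - #A) * p) := by
      rintro ⟨u, a⟩ hx
      rw [mem_product, mem_compl] at hx
      rw [bernProb_cylinder, card_union_of_disjoint, card_product, card_product, card_univ,
        card_compl, Fintype.card_fin, card_singleton, card_singleton, pow_add]
      · ring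
      · rw [Finset.disjoint_left]
        rintro ⟨u', v⟩ h1 h2
        simp only [mem_product, mem_singleton] at h1 h2
        exact hx.1 (h2.1 ▸ h1.1)
      · simp only [disjoint_singleton_right, mem_union, mem_product, mem_compl, not_or]
        tauto
    rw [sum_congr rfl h1, sum_const, card_product, card_compl, Fintype.card_fin, nsmul_eq_mul]
    have h2 : ((n - #A : ℕ) : ℝ) ≤ n := by exact_mod_cast Nat.sub_le _ _
    push_cast
    calc ((n - #A : ℕ) : ℝ) * #A * ((1 - p) ^ (n * #A) * ((1 - p) ^ (n - #A) * p))
        ≤ n * #A * ((1 - p) ^ (n * #A) * ((1 - p) ^ (n - #A) * p)) := by gcongr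
      _ = _ := by ring

lemma bernProb_violator_le {p : ℝ} (hp : p ∈ Set.Icc (0 : ℝ) 1) (A : Finset (Fin n))
    (Z N : Finset (Fin n) → Finset (Fin n) → Finset (Fin n × Fin n))
    (hd : ∀ I ⊆ Aᶜ, ∀ J ⊆ Aᶜ, Disjoint (Z I J) (N I J))
    (hZ : ∀ I ⊆ Aᶜ, ∀ J ⊆ Aᶜ, #(Z I J) = n * #A + #I * (n - #A - #J))
    (hN : ∀ I J, #(N I J) = #I * #J) :
    bernProb p {E | ∃ I ⊆ Aᶜ, ∃ J ⊆ Aᶜ, #J + 1 = #I ∧ 2 ≤ #I ∧ 2 * #I ≤ #Aᶜ + 1 ∧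
        Disjoint E (Z I J) ∧ 2 * #J ≤ #(E ∩ N I J)}
      ≤ (1 - p) ^ (n * #A) *
        ∑ s ∈ Icc 2 ((n - #A + 1) / 2), violatorTerm p (n - #A) s := by
  refine (bernProb_le_sum hp ((Icc 2 ((n - #A + 1) / 2)).sigma
    fun s => powersetCard s Aᶜ ×ˢ powersetCard (s - 1) Aᶜ) _
    (fun x => {E | Disjoint E (Z x.2.1 x.2.2) ∧ 2 * (x.1 - 1) ≤ #(E ∩ N x.2.1 x.2.2)}) ?_).trans ?_
  · rintro E ⟨I, hI, J, hJ, hc, h2, hm, hZE, hNE⟩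
    rw [card_compl, Fintype.card_fin] at hm
    refine ⟨⟨#I, I, J⟩, ?_, hZE, ?_⟩
    · simp only [mem_sigma, mem_Icc, mem_product, mem_powersetCard]
      refine ⟨⟨h2, by omega⟩, ⟨hI, trivial⟩, hJ, by omega⟩
    · simpa [← hc] using hNE
  · rw [sum_sigma, mul_sum]
    refine sum_le_sum fun s hs => ?_
    have h1 : ∀ x ∈ powersetCard s Aᶜ ×ˢ powersetCard (s - 1) Aᶜ,
        bernProb p {E | Disjoint E (Z x.1 x.2) ∧ 2 * (s - 1) ≤ #(E ∩ N x.1 x.2)}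
          ≤ (s * (s - 1)).choose (2 * (s - 1)) *
            ((1 - p) ^ (n * #A + s * (n - #A - (s - 1))) * p ^ (2 * (s - 1))) := by
      rintro ⟨I, J⟩ hx
      simp only [mem_product, mem_powersetCard] at hx
      obtain ⟨⟨hI, hIc⟩, hJ, hJc⟩ := hx
      have := bernProb_disjoint_card_inter_le hp (hd I hI J hJ) (2 * (s - 1))
      rwa [hZ I hI J hJ, hN, hIc, hJc] at this
    refine (sum_le_sum h1).trans_eq ?_
    rw [sum_const, card_product, card_powersetCard, card_powersetCard, card_compl,
      Fintype.card_fin, nsmul_eq_mul, violatorTerm, pow_add]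
    push_cast
    ring

lemma bernProb_nondiagonalizable_sinks_le {p : ℝ} (hp : p ∈ Set.Icc (0 : ℝ) 1)
    (A : Finset (Fin n)) :
    bernProb p {E | E ∈ nondiagonalizableOfNoSource n ∧ sinks E = A}
      ≤ (1 - p) ^ (n * #A) * min 1 (obstructionBound p n #A) := by
  have hq : 0 ≤ 1 - p := sub_nonneg.2 hp.2
  rw [mul_min_of_nonneg _ _ (by positivity)]
  refine le_min ?_ ?_
  · have h1 := bernProb_cylinder p (disjoint_empty_right (A ×ˢ (univ : Finset (Fin n))))
    rw [card_product, card_univ, Fintype.card_fin, card_empty, pow_zero, mul_comm (#A)] at h1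
    rw [← h1]
    exact bernProb_mono hp fun E hE => ⟨disjoint_product_sinks hE.2, empty_subset _⟩
  · have h1 := bernProb_singleton_obstruction_le hp A
    have h2 := bernProb_violator_le hp A (forbiddenOut A) (fun I J => I ×ˢ J)
      (fun I hI J _ => disjoint_forbiddenOut hI) (fun I hI J hJ => card_forbiddenOut hI hJ)
      (fun I J => card_product I J)
    have h3 := bernProb_violator_le hp A (forbiddenIn A) (fun I J => J ×ˢ I)
      (fun I _ J hJ => disjoint_forbiddenIn hJ) (fun I _ J hJ => card_forbiddenIn hJ)
      (fun I J => (card_product J I).trans (mul_comm _ _))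
    refine (bernProb_mono hp (fun E hE => ?_)).trans <| (bernProb_union_le hp _ _).trans <|
      (add_le_add h1 <| (bernProb_union_le hp _ _).trans <| add_le_add h2 h3).trans_eq ?_
    · rcases exists_obstruction hE.1 hE.2 with h | ⟨I, hI, J, hJ, hc, h2, hm, h | h⟩
      · exact Or.inl h
      · exact Or.inr (Or.inl ⟨I, hI, J, hJ, hc, h2, hm, h⟩)
      · exact Or.inr (Or.inr ⟨I, hI, J, hJ, hc, h2, hm, h⟩)
    · rw [obstructionBound]
      ring

lemma bernProb_nondiagonalizableOfNoSource_le {p : ℝ} (hp : p ∈ Set.Icc (0 : ℝ) 1) :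
    bernProb p (nondiagonalizableOfNoSource n)
      ≤ ∑' k : ℕ, n.choose k * (1 - p) ^ (n * k) * min 1 (obstructionBound p n k) := by
  refine (bernProb_le_sum hp univ _
    (fun A => {E | E ∈ nondiagonalizableOfNoSource n ∧ sinks E = A})
    fun E hE => ⟨sinks E, mem_univ _, hE, rfl⟩).trans ?_
  refine (sum_le_sum fun A _ => bernProb_nondiagonalizable_sinks_le hp A).trans_eq ?_
  rw [← powerset_univ, sum_powerset_apply_card
    (fun k => (1 - p) ^ (n * k) * min 1 (obstructionBound p n k)), card_univ, Fintype.card_fin,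
    tsum_eq_sum (s := range (n + 1))]
  · exact sum_congr rfl fun k _ => by rw [nsmul_eq_mul, mul_assoc]
  · intro k hk
    rw [Nat.choose_eq_zero_of_lt (by simpa using hk)]
    simp

end Structure

section InclusionExclusion

lemma indicator_forall_not_disjoint {α ι : Type*} [Fintype α] [DecidableEq α] [Fintype ι]
    [DecidableEq ι] (Z : ι → Finset α) (E : Finset α) :
    Set.indicator {E | ∀ i, ¬ Disjoint E (Z i)} (1 : Finset α → ℝ) E
      = ∑ A : Finset ι, (-1) ^ #A * (cylinder (A.biUnion Z) ∅).indicator (1 : Finset α → ℝ) E := by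
  have h1 : Set.indicator {E | ∀ i, ¬ Disjoint E (Z i)} (1 : Finset α → ℝ) E
      = ∏ i, (1 + -(if Disjoint E (Z i) then (1 : ℝ) else 0)) := by
    by_cases h : ∀ i, ¬ Disjoint E (Z i)
    · rw [Set.indicator_of_mem (s := {E | ∀ i, ¬ Disjoint E (Z i)}) h, prod_eq_one fun i _ => by simp [h i]]
      rfl
    · rw [Set.indicator_of_notMem (s := {E | ∀ i, ¬ Disjoint E (Z i)}) h]
      push Not at h
      obtain ⟨i, hi⟩ := h
      rw [prod_eq_zero (mem_univ i) (by simp [hi])]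
  rw [h1, prod_one_add, powerset_univ]
  refine sum_congr rfl fun A _ => ?_
  rw [prod_neg]
  congr 1
  by_cases h : ∀ i ∈ A, Disjoint E (Z i)
  · rw [Set.indicator_of_mem (show E ∈ cylinder _ ∅ from
      ⟨(disjoint_biUnion_right _ _ _).2 h, empty_subset _⟩), prod_eq_one fun i hi => by simp [h i hi]]
    rfl
  · rw [Set.indicator_of_notMem (s := cylinder _ ∅) fun hE =>
      h ((disjoint_biUnion_right _ _ _).1 hE.1)]
    push Not at h
    obtain ⟨i, hi, hd⟩ := h
    exact prod_eq_zero hi (by simp [hd])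

lemma sum_neg_one_pow_mul_pow (n : ℕ) (x : ℝ) :
    ∑ A : Finset (Fin n), (-1) ^ #A * x ^ #A = (1 - x) ^ n := by
  have := Fintype.sum_pow_mul_eq_add_pow (Fin n) (-x) 1
  simp only [one_pow, mul_one, Fintype.card_fin] at this
  rw [sub_eq_neg_add, ← this]
  exact sum_congr rfl fun A _ => by rw [← mul_pow, neg_one_mul]

variable (n : ℕ) (p : ℝ)

/-- The digraphs in which every vertex has positive out-degree. -/
def noSink : Set (Finset (Fin n × Fin n)) := {E | ∀ u, ¬ Disjoint E ({u} ×ˢ univ)}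

/-- The digraphs in which every vertex has positive in-degree. -/
def noSource : Set (Finset (Fin n × Fin n)) := {E | ∀ v, ¬ Disjoint E (univ ×ˢ {v})}

variable {n}

lemma mem_noSource {E : Finset (Fin n × Fin n)} : E ∈ noSource n ↔ ∀ v, ∃ u, (u, v) ∈ E := by
  refine forall_congr' fun v => ?_
  simp [Finset.not_disjoint_iff]

lemma mem_noSink {E : Finset (Fin n × Fin n)} : E ∈ noSink n ↔ ∀ u, ∃ v, (u, v) ∈ E := by
  refine forall_congr' fun v => ?_
  simp [Finset.not_disjoint_iff]

lemma map_edgeSwap_mem_noSource {E : Finset (Fin n × Fin n)} :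
    E.map (edgeSwap n).toEmbedding ∈ noSource n ↔ E ∈ noSink n := by
  simp only [mem_noSource, mem_noSink, mem_map_edgeSwap]

lemma biUnion_singleton_product (A : Finset (Fin n)) :
    (A.biUnion fun u => ({u} ×ˢ univ : Finset (Fin n × Fin n))) = A ×ˢ univ := by
  ext ⟨u, v⟩
  simp

lemma biUnion_product_singleton (B : Finset (Fin n)) :
    (B.biUnion fun v => (univ ×ˢ {v} : Finset (Fin n × Fin n))) = univ ×ˢ B := by
  ext ⟨u, v⟩
  simp

lemma bernProb_noSink : bernProb p (noSink n) = (1 - (1 - p) ^ n) ^ n := by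
  have h : (noSink n).indicator 1 = fun E => ∑ A : Finset (Fin n), (-1) ^ #A *
      (cylinder (A ×ˢ univ) ∅).indicator (1 : Finset (Fin n × Fin n) → ℝ) E := by
    funext E
    rw [noSink, indicator_forall_not_disjoint]
    simp only [biUnion_singleton_product]
  rw [bernProb, h, bernExp_sum, ← sum_neg_one_pow_mul_pow]
  refine sum_congr rfl fun A _ => ?_
  have h1 := bernProb_cylinder p (disjoint_empty_right (A ×ˢ (univ : Finset (Fin n))))
  rw [bernProb] at h1
  rw [bernExp_const_mul, h1, card_product, card_univ, Fintype.card_fin, card_empty, pow_zero,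
    mul_one, mul_comm (#A), pow_mul]

lemma bernProb_noSource : bernProb p (noSource n) = (1 - (1 - p) ^ n) ^ n := by
  rw [← bernProb_noSink, ← bernProb_preimage_map p (edgeSwap n) (noSource n)]
  congr 1
  ext E
  exact map_edgeSwap_mem_noSource

lemma card_product_union_product (A B : Finset (Fin n)) :
    #(A ×ˢ univ ∪ univ ×ˢ B) = n * #A + (n - #A) * #B := by
  have : A ×ˢ univ ∪ univ ×ˢ B = A ×ˢ univ ∪ Aᶜ ×ˢ B := by
    ext ⟨u, v⟩
    simp only [mem_union, mem_product, mem_univ, mem_compl, and_true, true_and]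
    tauto
  rw [this, card_union_of_disjoint, card_product, card_product, card_univ, card_compl,
    Fintype.card_fin, mul_comm]
  rw [Finset.disjoint_left]
  rintro ⟨u, v⟩ h1 h2
  exact mem_compl.1 (mem_product.1 h2).1 (mem_product.1 h1).1

lemma bernProb_noSink_inter_noSource : bernProb p (noSink n ∩ noSource n)
    = ∑' k : ℕ, n.choose k * (1 - p) ^ (n * k) * ((-1) ^ k * (1 - (1 - p) ^ (n - k)) ^ n) := by
  have h : (noSink n ∩ noSource n).indicator 1 = fun E =>
      ∑ A : Finset (Fin n), ∑ B : Finset (Fin n), (-1) ^ #A * (-1) ^ #B *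
      (cylinder (A ×ˢ univ ∪ univ ×ˢ B) ∅).indicator (1 : Finset (Fin n × Fin n) → ℝ) E := by
    funext E
    rw [Set.inter_indicator_one, Pi.mul_apply, noSink, noSource, indicator_forall_not_disjoint,
      indicator_forall_not_disjoint, sum_mul_sum]
    simp only [biUnion_singleton_product, biUnion_product_singleton]
    refine sum_congr rfl fun A _ => sum_congr rfl fun B _ => ?_
    have hc : cylinder (A ×ˢ univ ∪ univ ×ˢ B) ∅ = cylinder (A ×ˢ univ) ∅ ∩ cylinder (univ ×ˢ B) ∅ := by
      ext E
      simp [cylinder, disjoint_union_right]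
    rw [hc, Set.inter_indicator_one, Pi.mul_apply]
    ring
  have hcyl : ∀ A B : Finset (Fin n), bernExp p ((cylinder (A ×ˢ univ ∪ univ ×ˢ B) ∅).indicator 1)
      = (1 - p) ^ (n * #A) * ((1 - p) ^ (n - #A)) ^ #B := by
    intro A B
    have h1 := bernProb_cylinder p (disjoint_empty_right (A ×ˢ univ ∪ univ ×ˢ B))
    rw [bernProb] at h1
    rw [h1, card_product_union_product, card_empty, pow_zero, mul_one, pow_add, pow_mul _ (n - #A)]
  rw [bernProb, h, bernExp_sum]
  simp only [bernExp_sum, bernExp_const_mul, hcyl]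
  have hin : ∀ A : Finset (Fin n), ∑ B : Finset (Fin n),
      (-1) ^ #A * (-1) ^ #B * ((1 - p) ^ (n * #A) * ((1 - p) ^ (n - #A)) ^ #B)
      = (1 - p) ^ (n * #A) * ((-1) ^ #A * (1 - (1 - p) ^ (n - #A)) ^ n) := by
    intro A
    rw [← sum_neg_one_pow_mul_pow n ((1 - p) ^ (n - #A)), mul_sum, mul_sum]
    exact sum_congr rfl fun B _ => by ring
  simp only [hin]
  rw [← powerset_univ, sum_powerset_apply_card
    (fun k => (1 - p) ^ (n * k) * ((-1) ^ k * (1 - (1 - p) ^ (n - k)) ^ n)), card_univ,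
    Fintype.card_fin, tsum_eq_sum (s := range (n + 1))]
  · exact sum_congr rfl fun k _ => by rw [nsmul_eq_mul, mul_assoc]
  · intro k hk
    rw [Nat.choose_eq_zero_of_lt (by simpa using hk)]
    simp

lemma bernProb_structurallyDiagonalizable_ge {p : ℝ} (hp : p ∈ Set.Icc (0 : ℝ) 1) :
    bernProb p (noSink n) + bernProb p (noSource n) - bernProb p (noSink n ∩ noSource n)
        - 2 * bernProb p (nondiagonalizableOfNoSource n)
      ≤ bernProb p {E | StructurallyDiagonalizable n E} := by
  have h1 : bernProb p (noSink n ∪ noSource n) = bernProb p (noSink n) + bernProb p (noSource n)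
      - bernProb p (noSink n ∩ noSource n) := by
    simp only [bernProb]
    rw [← bernExp_add, ← bernExp_sub]
    congr 1
    funext E
    by_cases h1 : E ∈ noSink n <;> by_cases h2 : E ∈ noSource n <;> simp [h1, h2]
  have h2 := bernProb_preimage_map p (edgeSwap n) (nondiagonalizableOfNoSource n)
  have h3 : bernProb p (noSink n ∪ noSource n) ≤ bernProb p ({E | StructurallyDiagonalizable n E} ∪
      (nondiagonalizableOfNoSource n ∪
        {E | E.map (edgeSwap n).toEmbedding ∈ nondiagonalizableOfNoSource n})) := by
    refine bernProb_mono hp fun E hE => ?_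
    by_cases hsd : StructurallyDiagonalizable n E
    · exact Or.inl hsd
    · rcases hE with hE | hE
      · refine Or.inr (Or.inr ⟨mem_noSource.1 (map_edgeSwap_mem_noSource.2 hE), fun h => hsd ?_⟩)
        rw [← map_edgeSwap_map_edgeSwap E]
        exact h.map_edgeSwap
      · exact Or.inr (Or.inl ⟨mem_noSource.1 hE, hsd⟩)
  have h4 := h3.trans (bernProb_union_le hp _ _)
  have h5 := bernProb_union_le hp (nondiagonalizableOfNoSource n)
    {E | E.map (edgeSwap n).toEmbedding ∈ nondiagonalizableOfNoSource n}
  linarith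

end InclusionExclusion

section Asymptotics

open Topology

lemma violatorTerm_succ_le {p L D : ℝ} {n k t : ℕ} (hp : p ∈ Set.Icc (0 : ℝ) 1) (hp1 : p < 1)
    (ht : t + k ≤ n) (hk : 1 ≤ 2 * (1 - p) ^ k) (hL : n * (1 - p) ^ n ≤ L)
    (hD : 1 ≤ D * (1 - p) ^ (t + 1)) :
    violatorTerm p (n - k) (t + 1)
      ≤ 2 * Real.exp 2 * L * (2 * Real.exp 3 * L * (n * p ^ 2 * D)) ^ t := by
  have hp0 : 0 ≤ p := hp.1
  set q := 1 - p with hq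
  have hq0 : 0 < q := by linarith
  have hD0 : 0 ≤ D := by
    by_contra! h
    have : D * q ^ (t + 1) < 0 := mul_neg_of_neg_of_pos h (by positivity)
    linarith
  have hnk : ((n - k : ℕ) : ℝ) ≤ n := by exact_mod_cast Nat.sub_le _ _
  have hc1 : ((n - k).choose (t + 1) : ℝ) ≤ (n : ℝ) ^ (t + 1) / (t + 1).factorial :=
    (Nat.choose_le_pow_div _ _).trans (by gcongr)
  have hc2 : ((n - k).choose t : ℝ) ≤ (n : ℝ) ^ t / t.factorial :=
    (Nat.choose_le_pow_div _ _).trans (by gcongr)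
  have hc3 : (((t + 1) * t).choose (2 * t) : ℝ) ≤ ((t + 1 : ℕ) : ℝ) ^ (2 * t) * Real.exp t := by
    refine (Nat.choose_le_pow_div _ _).trans ?_
    rw [Nat.cast_mul, mul_pow, mul_div_assoc]
    gcongr
    exact Real.pow_div_factorial_le_exp _ (by positivity) _
  have he1 : ((t + 1 : ℕ) : ℝ) ^ t / t.factorial ≤ Real.exp (t + 1 : ℕ) :=
    Real.pow_div_factorial_le_exp _ (by positivity) _
  have he2 : ((t + 1 : ℕ) : ℝ) ^ t / (t + 1).factorial ≤ Real.exp (t + 1 : ℕ) := by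
    refine le_trans ?_ he1
    gcongr
    omega
  have hpow : q ^ ((t + 1) * (n - k - t)) ≤ (2 * q ^ n) ^ (t + 1) * D ^ t := by
    have e : q ^ ((t + 1) * (n - k - t)) * ((q ^ k) ^ (t + 1) * (q ^ (t + 1)) ^ t)
        = (q ^ n) ^ (t + 1) := by
      rw [← pow_mul, ← pow_mul, ← pow_mul, ← pow_add, ← pow_add]
      congr 1
      obtain ⟨d, rfl⟩ := Nat.exists_eq_add_of_le ht
      have : t + k + d - k - t = d := by omega
      rw [this]
      ring
    calc q ^ ((t + 1) * (n - k - t))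
        ≤ q ^ ((t + 1) * (n - k - t)) * ((2 * q ^ k) ^ (t + 1) * (D * q ^ (t + 1)) ^ t) := by
          refine le_mul_of_one_le_right (by positivity) ?_
          exact one_le_mul_of_one_le_of_one_le (one_le_pow₀ hk) (one_le_pow₀ hD)
      _ = 2 ^ (t + 1) * D ^ t *
          (q ^ ((t + 1) * (n - k - t)) * ((q ^ k) ^ (t + 1) * (q ^ (t + 1)) ^ t)) := by
          rw [mul_pow 2, mul_pow D]
          ring
      _ = _ := by
          rw [e, mul_pow 2]
          ring
  rw [violatorTerm]
  simp only [Nat.add_sub_cancel, ← hq]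
  have hexp : Real.exp (t + 1 : ℕ) * Real.exp (t + 1 : ℕ) * Real.exp t
      = Real.exp 2 * Real.exp 3 ^ t := by
    rw [← Real.exp_add, ← Real.exp_add, ← Real.exp_nat_mul, ← Real.exp_add]
    congr 1
    push_cast
    ring
  calc ((n - k).choose (t + 1) : ℝ) * (n - k).choose t *
        (((t + 1) * t).choose (2 * t) * (q ^ ((t + 1) * (n - k - t)) * p ^ (2 * t)))
      ≤ ((n : ℝ) ^ (t + 1) / (t + 1).factorial) * ((n : ℝ) ^ t / t.factorial) *
        ((((t + 1 : ℕ) : ℝ) ^ (2 * t) * Real.exp t) *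
          (((2 * q ^ n) ^ (t + 1) * D ^ t) * p ^ (2 * t))) := by
        gcongr
    _ = (((t + 1 : ℕ) : ℝ) ^ t / (t + 1).factorial) * (((t + 1 : ℕ) : ℝ) ^ t / t.factorial) *
        Real.exp t * ((2 * (n * q ^ n)) ^ (t + 1) * (n * p ^ 2 * D) ^ t) := by
        rw [mul_pow 2, mul_pow 2, mul_pow (n : ℝ) (q ^ n), mul_pow _ D, mul_pow (n : ℝ) (p ^ 2),
          ← pow_mul p, two_mul t, pow_add ((t + 1 : ℕ) : ℝ)]
        ring
    _ ≤ Real.exp (t + 1 : ℕ) * Real.exp (t + 1 : ℕ) *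
        Real.exp t * ((2 * L) ^ (t + 1) * (n * p ^ 2 * D) ^ t) := by
        gcongr
    _ = _ := by
        rw [hexp, pow_succ (2 * L), mul_pow (2 * Real.exp 3 * L) (n * p ^ 2 * D),
          mul_pow (2 * Real.exp 3) L, mul_pow 2 L, mul_pow 2 (Real.exp 3)]
        ring

lemma sum_geometric_tail_le {x : ℝ} (hx : 0 ≤ x) (hx2 : x ≤ 1 / 2) (N : ℕ) :
    ∑ s ∈ Icc 2 N, x ^ (s - 1) ≤ 2 * x := by
  rw [← Ico_add_one_right_eq_Icc, sum_Ico_eq_sum_range]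
  have h1 : ∀ i, x ^ (2 + i - 1) = x * x ^ i := fun i => by
    rw [show 2 + i - 1 = i + 1 by omega, pow_succ']
  simp only [h1]
  rw [← mul_sum, mul_comm 2]
  gcongr
  have h2 := geom_sum_mul_neg x (N + 1 - 2)
  have h3 : 0 ≤ x ^ (N + 1 - 2) := pow_nonneg hx _
  have h4 : 0 ≤ ∑ i ∈ range (N + 1 - 2), x ^ i := sum_nonneg fun i _ => pow_nonneg hx i
  nlinarith

variable {c : ℝ} {p : ℕ → ℝ}

lemma tendsto_mul_rpow_of_tendsto_sub_log
    (hlim : Tendsto (fun n : ℕ => (n : ℝ) * p n - Real.log n) atTop (𝓝 c)) :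
    Tendsto (fun n : ℕ => n * p n ^ 2 * √n) atTop (𝓝 0) := by
  have h1 : Tendsto (fun n : ℕ => (n : ℝ) ^ (-(1 / 4) : ℝ)) atTop (𝓝 0) :=
    (tendsto_rpow_neg_atTop (by norm_num)).comp tendsto_natCast_atTop_atTop
  have h2 : Tendsto (fun n : ℕ => Real.log n / (n : ℝ) ^ (1 / 4 : ℝ)) atTop (𝓝 0) :=
    (isLittleO_log_rpow_atTop (by norm_num)).tendsto_div_nhds_zero.comp tendsto_natCast_atTop_atTop
  have h3 := ((hlim.mul h1).add h2).pow 2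
  simp only [mul_zero, add_zero, ne_eq, OfNat.ofNat_ne_zero, not_false_eq_true, zero_pow] at h3
  refine h3.congr' ?_
  filter_upwards [eventually_gt_atTop 0] with n hn
  have hn' : (0 : ℝ) < n := by exact_mod_cast hn
  have hr : (0 : ℝ) < (n : ℝ) ^ (1 / 4 : ℝ) := by positivity
  have e1 : (n : ℝ) ^ (1 / 4 : ℝ) * (n : ℝ) ^ (1 / 4 : ℝ) = √n := by
    rw [← Real.rpow_add hn', Real.sqrt_eq_rpow]
    norm_num
  have e2 : √n * √n = (n : ℝ) := Real.mul_self_sqrt hn'.le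
  rw [Real.rpow_neg hn'.le, ← div_eq_mul_inv, ← add_div, sub_add_cancel, div_pow, sq ((n : ℝ) ^ _),
    e1, div_eq_iff (by positivity), mul_assoc, e2]
  ring

lemma tendsto_mul_sq (hlim : Tendsto (fun n : ℕ => (n : ℝ) * p n - Real.log n) atTop (𝓝 c)) :
    Tendsto (fun n : ℕ => n * p n ^ 2) atTop (𝓝 0) := by
  refine squeeze_zero' (Eventually.of_forall fun n => by positivity) ?_
    (tendsto_mul_rpow_of_tendsto_sub_log hlim)
  filter_upwards [eventually_ge_atTop 1] with n hn
  refine le_mul_of_one_le_right (by positivity) (Real.one_le_sqrt.2 (by exact_mod_cast hn))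

lemma tendsto_zero_of_tendsto_sub_log
    (hlim : Tendsto (fun n : ℕ => (n : ℝ) * p n - Real.log n) atTop (𝓝 c)) :
    Tendsto p atTop (𝓝 0) := by
  have h : Tendsto (fun n => p n ^ 2) atTop (𝓝 0) := by
    refine squeeze_zero' (Eventually.of_forall fun n => by positivity) ?_ (tendsto_mul_sq hlim)
    filter_upwards [eventually_ge_atTop 1] with n hn
    exact le_mul_of_one_le_left (by positivity) (by exact_mod_cast hn)
  have := h.sqrt
  simp only [Real.sqrt_sq_eq_abs, Real.sqrt_zero] at this
  exact (tendsto_zero_iff_abs_tendsto_zero p).2 this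

lemma tendsto_mul_one_sub_pow (hp : ∀ n, p n ∈ Set.Icc (0 : ℝ) 1)
    (hlim : Tendsto (fun n : ℕ => (n : ℝ) * p n - Real.log n) atTop (𝓝 c)) :
    Tendsto (fun n : ℕ => n * (1 - p n) ^ n) atTop (𝓝 (Real.exp (-c))) := by
  have hp0 := tendsto_zero_of_tendsto_sub_log hlim
  have hhalf : ∀ᶠ n in atTop, p n < 1 / 2 := hp0.eventually (Iio_mem_nhds (by norm_num))
  have h1 : Tendsto (fun n : ℕ => n * (p n + Real.log (1 - p n))) atTop (𝓝 0) := by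
    have h2 : Tendsto (fun n : ℕ => 2 * (n * p n ^ 2)) atTop (𝓝 0) := by
      simpa using (tendsto_mul_sq hlim).const_mul 2
    refine squeeze_zero_norm' ?_ h2
    filter_upwards [hhalf] with n hn
    have hpn := (hp n).1
    have h3 := Real.abs_log_sub_add_sum_range_le (x := p n) (by rw [abs_of_nonneg hpn]; linarith) 1
    rw [abs_of_nonneg hpn] at h3
    simp only [sum_range_one, zero_add, pow_one, Nat.cast_zero, div_one] at h3
    rw [Real.norm_eq_abs, abs_mul, Nat.abs_cast]
    calc (n : ℝ) * |p n + Real.log (1 - p n)| ≤ n * (p n ^ (1 + 1) / (1 - p n)) := by gcongr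
      _ ≤ n * (2 * p n ^ 2) := by
        gcongr
        rw [div_le_iff₀ (by linarith)]
        rw [one_add_one_eq_two]
        nlinarith [mul_nonneg (sq_nonneg (p n)) (show 0 ≤ 1 - 2 * p n by linarith)]
      _ = _ := by ring
  have h2 := (Real.continuous_exp.tendsto _).comp (hlim.neg.add h1)
  rw [add_zero] at h2
  refine h2.congr' ?_
  filter_upwards [hhalf, eventually_gt_atTop 0] with n hn hn0
  have hq : 0 < 1 - p n := by linarith
  have hn' : (0 : ℝ) < n := by exact_mod_cast hn0
  have : -(n * p n - Real.log n) + n * (p n + Real.log (1 - p n))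
      = Real.log n + n * Real.log (1 - p n) := by ring
  rw [Function.comp_apply, this, Real.exp_add, Real.exp_log hn', Real.exp_nat_mul, Real.exp_log hq]

lemma tendsto_mul_one_sub_pow_sub (hp : ∀ n, p n ∈ Set.Icc (0 : ℝ) 1)
    (hlim : Tendsto (fun n : ℕ => (n : ℝ) * p n - Real.log n) atTop (𝓝 c)) (k : ℕ) :
    Tendsto (fun n : ℕ => n * (1 - p n) ^ (n - k)) atTop (𝓝 (Real.exp (-c))) := by
  have hp0 := tendsto_zero_of_tendsto_sub_log hlim
  have h1 : Tendsto (fun n => ((1 - p n) ^ k)⁻¹) atTop (𝓝 1) := by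
    simpa using ((tendsto_const_nhds (x := (1 : ℝ)).sub hp0).pow k).inv₀ (by simp)
  have h2 := (tendsto_mul_one_sub_pow hp hlim).mul h1
  rw [mul_one] at h2
  refine h2.congr' ?_
  filter_upwards [eventually_ge_atTop k, hp0.eventually (Iio_mem_nhds one_pos)] with n hn hn1
  rw [pow_sub₀ _ (sub_pos.2 hn1).ne' hn, mul_assoc]

lemma tendsto_one_sub_pow_sub_pow (hp : ∀ n, p n ∈ Set.Icc (0 : ℝ) 1)
    (hlim : Tendsto (fun n : ℕ => (n : ℝ) * p n - Real.log n) atTop (𝓝 c)) (k : ℕ) :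
    Tendsto (fun n : ℕ => (1 - (1 - p n) ^ (n - k)) ^ n) atTop
      (𝓝 (Real.exp (-Real.exp (-c)))) := by
  have := Real.tendsto_one_add_pow_exp_of_tendsto (g := fun n => -(1 - p n) ^ (n - k))
    (t := -Real.exp (-c)) (by simpa using (tendsto_mul_one_sub_pow_sub hp hlim k).neg)
  simpa [sub_eq_add_neg] using this

lemma tendsto_tsum_choose_mul (hp : ∀ n, p n ∈ Set.Icc (0 : ℝ) 1)
    (hlim : Tendsto (fun n : ℕ => (n : ℝ) * p n - Real.log n) atTop (𝓝 c))
    {b : ℕ → ℕ → ℝ} {β : ℕ → ℝ} (hb : ∀ n k, |b n k| ≤ 1)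
    (hβ : ∀ k, Tendsto (fun n => b n k) atTop (𝓝 (β k))) :
    Tendsto (fun n : ℕ => ∑' k : ℕ, n.choose k * (1 - p n) ^ (n * k) * b n k) atTop
      (𝓝 (∑' k : ℕ, Real.exp (-c) ^ k / k.factorial * β k)) := by
  have hx := tendsto_mul_one_sub_pow hp hlim
  refine tendsto_tsum_of_dominated_convergence
    (Real.summable_pow_div_factorial (Real.exp (-c) + 1)) (fun k => ?_) ?_
  · have h1 := ProbabilityTheory.tendsto_choose_mul_pow_atTop k hx
    simp only [← pow_mul] at h1
    exact h1.mul (hβ k)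
  · filter_upwards [hx.eventually (Iio_mem_nhds (lt_add_one _))] with n hn k
    have hq : 0 ≤ 1 - p n := sub_nonneg.2 (hp n).2
    rw [Real.norm_eq_abs, abs_mul, abs_of_nonneg (by positivity)]
    calc (n.choose k : ℝ) * (1 - p n) ^ (n * k) * |b n k|
        ≤ (n ^ k / k.factorial) * (1 - p n) ^ (n * k) * 1 := by
          gcongr
          · exact Nat.choose_le_pow_div _ _
          · exact hb n k
      _ = (n * (1 - p n) ^ n) ^ k / k.factorial := by rw [mul_pow, ← pow_mul]; ring
      _ ≤ _ := by gcongr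

lemma violatorTerm_nonneg {p : ℝ} (hp : p ∈ Set.Icc (0 : ℝ) 1) (m s : ℕ) :
    0 ≤ violatorTerm p m s := by
  have hq : 0 ≤ 1 - p := sub_nonneg.2 hp.2
  have := hp.1
  unfold violatorTerm
  positivity

lemma tendsto_sum_violatorTerm (hp : ∀ n, p n ∈ Set.Icc (0 : ℝ) 1)
    (hlim : Tendsto (fun n : ℕ => (n : ℝ) * p n - Real.log n) atTop (𝓝 c)) (k : ℕ) :
    Tendsto (fun n : ℕ => ∑ s ∈ Icc 2 ((n - k + 1) / 2), violatorTerm (p n) (n - k) s) atTop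
      (𝓝 0) := by
  have hp0 := tendsto_zero_of_tendsto_sub_log hlim
  have hx := tendsto_mul_one_sub_pow hp hlim
  set l := Real.exp (-c) with hl
  have hl0 : 0 < l := Real.exp_pos _
  set D : ℕ → ℝ := fun n => √(4 / l) * √n with hD
  set x : ℕ → ℝ := fun n => 2 * Real.exp 3 * (l + 1) * (n * p n ^ 2 * D n) with hxdef
  have hxlim : Tendsto x atTop (𝓝 0) := by
    have := (tendsto_mul_rpow_of_tendsto_sub_log hlim).const_mul
      (2 * Real.exp 3 * (l + 1) * √(4 / l))
    rw [mul_zero] at this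
    refine this.congr fun n => ?_
    simp only [hxdef, hD]
    ring
  have hbound : Tendsto (fun n => 2 * Real.exp 2 * (l + 1) * (2 * x n)) atTop (𝓝 0) := by
    simpa using (hxlim.const_mul 2).const_mul (2 * Real.exp 2 * (l + 1))
  have hqk : Tendsto (fun n => 2 * (1 - p n) ^ k) atTop (𝓝 2) := by
    simpa using ((tendsto_const_nhds (x := (1 : ℝ)).sub hp0).pow k).const_mul 2
  refine squeeze_zero' (Eventually.of_forall fun n =>
    sum_nonneg fun s _ => violatorTerm_nonneg (hp n) _ _) ?_ hbound
  filter_upwards [eventually_ge_atTop (k + 1), hp0.eventually (Iio_mem_nhds one_half_pos),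
    hqk.eventually (Ioi_mem_nhds one_lt_two), hx.eventually (Iio_mem_nhds (lt_add_one l)),
    hx.eventually (Ioi_mem_nhds (half_lt_self hl0)),
    hxlim.eventually (Iio_mem_nhds one_half_pos)] with n hnk hn2 hnq hnL hnl hnx
  have hq : 0 < 1 - p n := by linarith
  have hpn := (hp n).1
  have hn' : (0 : ℝ) < n := by exact_mod_cast (show 0 < n by omega)
  have hx0 : 0 ≤ x n := by simp only [hxdef, hD]; positivity
  have hterm : ∀ s ∈ Icc 2 ((n - k + 1) / 2), violatorTerm (p n) (n - k) s
      ≤ 2 * Real.exp 2 * (l + 1) * x n ^ (s - 1) := by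
    intro s hs
    rw [Finset.mem_Icc] at hs
    obtain ⟨t, rfl⟩ : ∃ t, s = t + 1 := ⟨s - 1, by omega⟩
    refine violatorTerm_succ_le (hp n) (by linarith) (by omega) hnq.le hnL.le ?_
    have h1 : (1 - p n) ^ (n + 1) ≤ ((1 - p n) ^ (t + 1)) ^ 2 := by
      rw [← pow_mul]
      exact pow_le_pow_of_le_one hq.le (by linarith) (by omega)
    have h2 : 1 ≤ (4 / l * n) * ((1 - p n) ^ (t + 1)) ^ 2 := by
      calc (1 : ℝ) = 4 / l * (l / 2 * (1 / 2)) := by field_simp; norm_num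
        _ ≤ 4 / l * ((n * (1 - p n) ^ n) * (1 - p n)) := by
          gcongr
          linarith
        _ = (4 / l * n) * (1 - p n) ^ (n + 1) := by ring
        _ ≤ _ := by gcongr
    simp only [hD]
    rw [← Real.sqrt_mul (by positivity)]
    rw [← Real.sqrt_sq (pow_nonneg hq.le (t + 1)), ← Real.sqrt_mul (by positivity)]
    exact Real.one_le_sqrt.2 h2
  refine (sum_le_sum hterm).trans ?_
  rw [← mul_sum]
  gcongr
  exact sum_geometric_tail_le hx0 hnx.le _

lemma obstructionBound_nonneg {p : ℝ} (hp : p ∈ Set.Icc (0 : ℝ) 1) (n k : ℕ) :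
    0 ≤ obstructionBound p n k := by
  have hq : 0 ≤ 1 - p := sub_nonneg.2 hp.2
  have := hp.1
  have := sum_nonneg fun s (_ : s ∈ Icc 2 ((n - k + 1) / 2)) => violatorTerm_nonneg hp (n - k) s
  unfold obstructionBound
  positivity

lemma tendsto_obstructionBound (hp : ∀ n, p n ∈ Set.Icc (0 : ℝ) 1)
    (hlim : Tendsto (fun n : ℕ => (n : ℝ) * p n - Real.log n) atTop (𝓝 c)) (k : ℕ) :
    Tendsto (fun n : ℕ => obstructionBound (p n) n k) atTop (𝓝 0) := by
  have h1 := ((tendsto_mul_one_sub_pow_sub hp hlim k).mul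
    (tendsto_zero_of_tendsto_sub_log hlim)).const_mul (k : ℝ)
  have h2 := h1.add ((tendsto_sum_violatorTerm hp hlim k).const_mul 2)
  simp only [mul_zero, add_zero] at h2
  refine h2.congr fun n => ?_
  rw [obstructionBound]
  ring

lemma tendsto_bernProb_nondiagonalizableOfNoSource (hp : ∀ n, p n ∈ Set.Icc (0 : ℝ) 1)
    (hlim : Tendsto (fun n : ℕ => (n : ℝ) * p n - Real.log n) atTop (𝓝 c)) :
    Tendsto (fun n : ℕ => bernProb (p n) (nondiagonalizableOfNoSource n)) atTop (𝓝 0) := by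
  have h := tendsto_tsum_choose_mul hp hlim
    (b := fun n k => min 1 (obstructionBound (p n) n k)) (β := fun _ => 0) (fun n k => by
      rw [abs_of_nonneg (le_min zero_le_one (obstructionBound_nonneg (hp n) n k))]
      exact min_le_left _ _) (fun k => by
      simpa using (tendsto_const_nhds (x := (1 : ℝ))).min (tendsto_obstructionBound hp hlim k))
  simp only [mul_zero, tsum_zero] at h
  exact squeeze_zero (fun n => bernProb_nonneg (hp n) _)
    (fun n => bernProb_nondiagonalizableOfNoSource_le (hp n)) h

lemma tendsto_bernProb_noSink_inter_noSource (hp : ∀ n, p n ∈ Set.Icc (0 : ℝ) 1)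
    (hlim : Tendsto (fun n : ℕ => (n : ℝ) * p n - Real.log n) atTop (𝓝 c)) :
    Tendsto (fun n : ℕ => bernProb (p n) (noSink n ∩ noSource n)) atTop
      (𝓝 (Real.exp (-(2 * Real.exp (-c))))) := by
  simp only [bernProb_noSink_inter_noSource]
  have h := tendsto_tsum_choose_mul hp hlim
    (b := fun n k => (-1) ^ k * (1 - (1 - p n) ^ (n - k)) ^ n)
    (β := fun k => (-1) ^ k * Real.exp (-Real.exp (-c))) (fun n k => by
      have hq : 0 ≤ 1 - p n := sub_nonneg.2 (hp n).2
      have hq1 : (1 - p n) ^ (n - k) ≤ 1 := pow_le_one₀ hq (by linarith [(hp n).1])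
      have hq0 : 0 ≤ (1 - p n) ^ (n - k) := by positivity
      rw [abs_mul, abs_pow, abs_neg, abs_one, one_pow, one_mul, abs_pow]
      exact pow_le_one₀ (abs_nonneg _) (by rw [abs_of_nonneg] <;> linarith))
    (fun k => (tendsto_one_sub_pow_sub_pow hp hlim k).const_mul _)
  convert h using 2
  have h1 : ∀ k : ℕ, Real.exp (-c) ^ k / k.factorial * ((-1) ^ k * Real.exp (-Real.exp (-c)))
      = (-Real.exp (-c)) ^ k / k.factorial * Real.exp (-Real.exp (-c)) := by
    intro k
    rw [neg_pow (Real.exp (-c))]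
    ring
  have h2 : ∑' k : ℕ, (-Real.exp (-c)) ^ k / k.factorial = Real.exp (-Real.exp (-c)) := by
    rw [Real.exp_eq_exp_ℝ]
    exact (NormedSpace.expSeries_div_hasSum_exp _).tsum_eq
  simp only [h1]
  rw [tsum_mul_right, h2, ← Real.exp_add]
  congr 1
  ring

end Asymptotics

/-- If `n·p_n - log n → c`, then
`liminf P(G_{n,p_n} ∈ D^n) ≥ exp(-2·exp(-c))·(1 + 2·exp(-c) + exp(-2c))`. -/
theorem liminf_prob_structurallyDiagonalizable_ge (c : ℝ) (p : ℕ → ℝ)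
    (hp : ∀ n, p n ∈ Set.Icc (0 : ℝ) 1)
    (hlim : Tendsto (fun n : ℕ => (n : ℝ) * p n - Real.log n) atTop (nhds c)) :
    Real.exp (-(2 * Real.exp (-c))) * (1 + 2 * Real.exp (-c) + Real.exp (-(2 * c)))
      ≤ liminf (fun n : ℕ =>
          digraphProb n (p n) (p n) {E | StructurallyDiagonalizable n E}) atTop := by
  simp only [digraphProb_eq_bernProb]
  have h1 : Tendsto (fun n : ℕ => bernProb (p n) (noSink n)) atTop
      (nhds (Real.exp (-Real.exp (-c)))) := by
    simpa [bernProb_noSink] using tendsto_one_sub_pow_sub_pow hp hlim 0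
  have h2 : Tendsto (fun n : ℕ => bernProb (p n) (noSource n)) atTop
      (nhds (Real.exp (-Real.exp (-c)))) := by
    simpa [bernProb_noSource] using tendsto_one_sub_pow_sub_pow hp hlim 0
  have h3 := ((h1.add h2).sub (tendsto_bernProb_noSink_inter_noSource hp hlim)).sub
    ((tendsto_bernProb_nondiagonalizableOfNoSource hp hlim).const_mul 2)
  have h4 : Real.exp (-(2 * Real.exp (-c))) * (1 + 2 * Real.exp (-c) + Real.exp (-(2 * c)))
      ≤ Real.exp (-Real.exp (-c)) + Real.exp (-Real.exp (-c)) - Real.exp (-(2 * Real.exp (-c)))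
        - 2 * 0 := by
    set l := Real.exp (-c) with hl
    have e1 : Real.exp (-(2 * c)) = l ^ 2 := by
      rw [hl, ← Real.exp_nat_mul]
      congr 1
      push_cast
      ring
    have e2 : Real.exp (-l) = Real.exp (-(2 * l)) * Real.exp l := by
      rw [← Real.exp_add]
      congr 1
      ring
    have hq := Real.quadratic_le_exp_of_nonneg (x := l) (Real.exp_pos _).le
    have hpos := Real.exp_pos (-(2 * l))
    rw [e1, e2]
    nlinarith
  refine h4.trans ?_
  rw [← h3.liminf_eq]
  refine liminf_le_liminf
    (Eventually.of_forall fun n => bernProb_structurallyDiagonalizable_ge (hp n))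
    h3.isBoundedUnder_ge ?_
  refine IsBoundedUnder.isCoboundedUnder_ge (isBoundedUnder_of ⟨1, fun n => ?_⟩)
  rw [← bernProb_univ (α := Fin n × Fin n) (p n)]
  exact bernProb_mono (hp n) (Set.subset_univ _)
end

section
/- Let c ∈ ℝ and let (p_n) be a sequence in [0,1] with n·p_n − log n → c. Then limsup_{n→∞} P(G_{n,p_n} ∈ D^n) ≤ 1 − e^{−2e^{−c}}·e^{−2c}, where G_{n,p_n} is a digraph drawn from the random digraph model G(n, p_n) and D^n is the set of structurally diagonalizable n-vertex digraphs. -/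
open Finset Filter

section BernoulliSubset

variable {ι κ : Type*} [Fintype ι] [DecidableEq ι]

/-- The probability of the set `E` under the product Bernoulli measure with parameter `p`. -/
def bernoulliWeight (p : ℝ) (E : Finset ι) : ℝ := p ^ #E * (1 - p) ^ #Eᶜ

open Classical in
/-- The probability of the event `Q` under the product Bernoulli measure with parameter `p`. -/
noncomputable def bernoulliProb (p : ℝ) (Q : Finset ι → Prop) : ℝ :=
  ∑ E with Q E, bernoulliWeight p E

lemma bernoulliWeight_nonneg {p : ℝ} (hp : p ∈ Set.Icc (0 : ℝ) 1) (E : Finset ι) :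
    0 ≤ bernoulliWeight p E :=
  mul_nonneg (pow_nonneg hp.1 _) (pow_nonneg (sub_nonneg.2 hp.2) _)

lemma bernoulliProb_nonneg {p : ℝ} (hp : p ∈ Set.Icc (0 : ℝ) 1) (Q : Finset ι → Prop) :
    0 ≤ bernoulliProb p Q :=
  Finset.sum_nonneg fun E _ => bernoulliWeight_nonneg hp E

lemma bernoulliProb_mono {p : ℝ} (hp : p ∈ Set.Icc (0 : ℝ) 1) {Q R : Finset ι → Prop}
    (h : ∀ E, Q E → R E) : bernoulliProb p Q ≤ bernoulliProb p R := by
  classical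
  exact Finset.sum_le_sum_of_subset_of_nonneg (Finset.monotone_filter_right _ fun E _ => h E)
    fun E _ _ => bernoulliWeight_nonneg hp E

lemma bernoulliProb_exists_le {p : ℝ} (hp : p ∈ Set.Icc (0 : ℝ) 1) (s : Finset κ)
    (Q : κ → Finset ι → Prop) :
    bernoulliProb p (fun E => ∃ k ∈ s, Q k E) ≤ ∑ k ∈ s, bernoulliProb p (Q k) := by
  classical
  simp only [bernoulliProb, Finset.sum_filter]
  rw [Finset.sum_comm]
  refine Finset.sum_le_sum fun E _ => ?_
  have hw := bernoulliWeight_nonneg hp E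
  have hpos : ∀ k ∈ s, 0 ≤ if Q k E then bernoulliWeight p E else 0 := fun k _ => by
    split_ifs <;> simp [hw]
  split_ifs with h
  · obtain ⟨k, hk, hQ⟩ := h
    simpa [hQ] using Finset.single_le_sum hpos hk
  · exact Finset.sum_nonneg hpos

lemma bernoulliProb_or_le {p : ℝ} (hp : p ∈ Set.Icc (0 : ℝ) 1) (Q R : Finset ι → Prop) :
    bernoulliProb p (fun E => Q E ∨ R E) ≤ bernoulliProb p Q + bernoulliProb p R := by
  classical
  simp only [bernoulliProb, Finset.sum_filter]
  rw [← Finset.sum_add_distrib]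
  refine Finset.sum_le_sum fun E _ => ?_
  have hw := bernoulliWeight_nonneg hp E
  by_cases hQ : Q E <;> by_cases hR : R E <;> simp [hQ, hR, hw]

lemma bernoulliProb_subset_disjoint (p : ℝ) {S T : Finset ι} (h : Disjoint S T) :
    bernoulliProb p (fun E => T ⊆ E ∧ Disjoint S E) = p ^ #T * (1 - p) ^ #S := by
  classical
  have key := Fintype.prod_add (fun i => if i ∈ S then 0 else p)
    (fun i => if i ∈ T then 0 else 1 - p)
  rw [bernoulliProb, Finset.sum_filter]
  trans ∑ E : Finset ι, (∏ a ∈ E, if a ∈ S then 0 else p) * ∏ a ∈ Eᶜ, if a ∈ T then 0 else 1 - p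
  · refine Finset.sum_congr rfl fun E _ => ?_
    split_ifs with hE
    · have h1 : ∀ a ∈ E, (if a ∈ S then 0 else p) = p := fun a ha =>
        if_neg fun haS => Finset.disjoint_left.1 hE.2 haS ha
      have h2 : ∀ a ∈ Eᶜ, (if a ∈ T then 0 else 1 - p) = 1 - p := fun a ha =>
        if_neg fun haT => Finset.mem_compl.1 ha (hE.1 haT)
      rw [Finset.prod_congr rfl h1, Finset.prod_congr rfl h2, Finset.prod_const,
        Finset.prod_const, bernoulliWeight]
    · by_cases hT : T ⊆ E
      · have : ¬Disjoint S E := fun h => hE ⟨hT, h⟩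
        obtain ⟨a, haS, haE⟩ := Finset.not_disjoint_iff.1 this
        rw [Finset.prod_eq_zero haE (by simp [haS]), zero_mul]
      · obtain ⟨a, haT, haE⟩ := Finset.not_subset.1 hT
        rw [Finset.prod_eq_zero (s := Eᶜ) (Finset.mem_compl.2 haE) (by simp [haT]), mul_zero]
  · rw [← key]
    trans ∏ a, (if a ∈ T then p else 1) * (if a ∈ S then 1 - p else 1)
    · refine Finset.prod_congr rfl fun a _ => ?_
      have := fun hS : a ∈ S => Finset.disjoint_left.1 h hS
      by_cases hS : a ∈ S <;> by_cases hT : a ∈ T <;> simp_all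
    · rw [Finset.prod_mul_distrib, Finset.prod_ite_mem, Finset.prod_ite_mem]
      simp

lemma bernoulliProb_true (p : ℝ) : bernoulliProb p (fun _ : Finset ι => True) = 1 := by
  simpa using bernoulliProb_subset_disjoint p (S := (∅ : Finset ι)) (T := ∅) (by simp)

lemma bernoulliProb_not (p : ℝ) (Q : Finset ι → Prop) :
    bernoulliProb p (fun E => ¬Q E) = 1 - bernoulliProb p Q := by
  classical
  rw [← bernoulliProb_true (ι := ι) p, eq_sub_iff_add_eq, add_comm]
  simpa [bernoulliProb] using
    Finset.sum_filter_add_sum_filter_not univ Q (bernoulliWeight p)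

lemma bernoulliWeight_map {β : Type*} [Fintype β] [DecidableEq β] (f : ι ↪ β) (p : ℝ)
    (E : Finset ι) :
    bernoulliWeight p (E.map f) =
      (1 - p) ^ (Fintype.card β - Fintype.card ι) * bernoulliWeight p E := by
  have h1 := E.card_le_univ
  have h2 := Fintype.card_le_of_embedding f
  have h3 : #(E.map f)ᶜ = (Fintype.card β - Fintype.card ι) + #Eᶜ := by
    rw [Finset.card_compl, Finset.card_compl, Finset.card_map]
    omega
  rw [bernoulliWeight, bernoulliWeight, h3, Finset.card_map, pow_add]
  ring

lemma bernoulliProb_comp_map (e : ι ≃ ι) (p : ℝ) (Q : Finset ι → Prop) :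
    bernoulliProb p (fun E => Q (E.map e.toEmbedding)) = bernoulliProb p Q := by
  classical
  rw [bernoulliProb, bernoulliProb, Finset.sum_filter, Finset.sum_filter]
  refine Fintype.sum_equiv e.finsetCongr _ _ fun E => ?_
  have := bernoulliWeight_map e.toEmbedding p E
  simp only [Equiv.finsetCongr_apply]
  simp [this]

lemma bernoulliProb_mul_le {p : ℝ} (hp : p ∈ Set.Icc (0 : ℝ) 1) {Q R : Finset ι → Prop}
    (hQ : Monotone Q) (hR : Monotone R) :
    bernoulliProb p Q * bernoulliProb p R ≤ bernoulliProb p (fun E => Q E ∧ R E) := by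
  classical
  have hind : ∀ {Q : Finset ι → Prop}, Monotone Q →
      Monotone fun E => if Q E then (1 : ℝ) else 0 := by
    intro Q hQ E F hEF
    by_cases hE : Q E
    · simp [hE, hQ hEF hE]
    · by_cases hF : Q F <;> simp [hE, hF]
  have key := fkg (μ := bernoulliWeight (ι := ι) p) (f := fun E => if Q E then (1 : ℝ) else 0)
    (g := fun E => if R E then (1 : ℝ) else 0) (fun E => bernoulliWeight_nonneg hp E)
    (fun E => by dsimp; split_ifs <;> norm_num) (fun E => by dsimp; split_ifs <;> norm_num)
    (hind hQ) (hind hR) (fun E F => by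
      have h1 := Finset.card_inter_add_card_union E F
      have h2 := Finset.card_inter_add_card_union Eᶜ Fᶜ
      rw [← Finset.compl_union, ← Finset.compl_inter] at h2
      apply le_of_eq
      simp only [bernoulliWeight, Finset.inf_eq_inter, Finset.sup_eq_union]
      calc _ = p ^ (#E + #F) * (1 - p) ^ (#Eᶜ + #Fᶜ) := by ring
        _ = _ := by rw [← h1, ← h2]; ring)
  have htrue : ∑ E : Finset ι, bernoulliWeight p E = 1 := by
    simpa [bernoulliProb] using bernoulliProb_true (ι := ι) p
  have hboth : ∀ E, (if Q E then (1 : ℝ) else 0) * (if R E then 1 else 0) =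
      if Q E ∧ R E then 1 else 0 := fun E => by
    by_cases hE : Q E <;> by_cases hE' : R E <;> simp [hE, hE']
  simpa only [htrue, hboth, one_mul, mul_ite, mul_one, mul_zero, bernoulliProb,
    Finset.sum_filter] using key

lemma prod_le_bernoulliProb_forall {p : ℝ} (hp : p ∈ Set.Icc (0 : ℝ) 1) (s : Finset κ)
    {Q : κ → Finset ι → Prop} (hQ : ∀ k, Monotone (Q k)) :
    ∏ k ∈ s, bernoulliProb p (Q k) ≤ bernoulliProb p (fun E => ∀ k ∈ s, Q k E) := by
  classical
  induction s using Finset.induction_on with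
  | empty => simp [bernoulliProb_true]
  | insert a s ha ih =>
    rw [Finset.prod_insert ha]
    refine (mul_le_mul_of_nonneg_left ih (bernoulliProb_nonneg hp _)).trans ?_
    refine (bernoulliProb_mul_le hp (R := fun E => ∀ k ∈ s, Q k E) (hQ a)
      fun E F hEF h k hk => hQ k hEF (h k hk)).trans ?_
    exact bernoulliProb_mono hp fun E h => by simpa using h

lemma bernoulliProb_not_disjoint (p : ℝ) (S : Finset ι) :
    bernoulliProb p (fun E => ¬Disjoint S E) = 1 - (1 - p) ^ #S := by
  rw [bernoulliProb_not]
  simpa using bernoulliProb_subset_disjoint p (S := S) (T := ∅) (by simp)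

end BernoulliSubset

section Hall

variable {m : ℕ}

lemma mem_leftNbhd {E : Finset (Fin m × Fin m)} {I : Finset (Fin m)} {v : Fin m} :
    v ∈ leftNbhd m E I ↔ ∃ u ∈ I, (u, v) ∈ E := by
  simp [leftNbhd]

lemma mem_rightNbhd {E : Finset (Fin m × Fin m)} {I : Finset (Fin m)} {u : Fin m} :
    u ∈ rightNbhd m E I ↔ ∃ v ∈ I, (u, v) ∈ E := by
  simp [rightNbhd]

/-- The reversed digraph. -/
def reverseEdges (E : Finset (Fin m × Fin m)) : Finset (Fin m × Fin m) :=
  E.map (Equiv.prodComm (Fin m) (Fin m)).toEmbedding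

lemma mem_reverseEdges {E : Finset (Fin m × Fin m)} {u v : Fin m} :
    (u, v) ∈ reverseEdges E ↔ (v, u) ∈ E := by
  simp [reverseEdges]

lemma leftNbhd_reverseEdges (E : Finset (Fin m × Fin m)) (I : Finset (Fin m)) :
    leftNbhd m (reverseEdges E) I = rightNbhd m E I := by
  ext u
  simp [mem_leftNbhd, mem_rightNbhd, mem_reverseEdges]

lemma reverseEdges_reverseEdges (E : Finset (Fin m × Fin m)) :
    reverseEdges (reverseEdges E) = E := by
  ext ⟨u, v⟩
  simp [mem_reverseEdges]

lemma leftNbhd_mono {E : Finset (Fin m × Fin m)} {I J : Finset (Fin m)} (h : I ⊆ J) :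
    leftNbhd m E I ⊆ leftNbhd m E J := fun v hv => by
  obtain ⟨u, hu, huv⟩ := mem_leftNbhd.1 hv
  exact mem_leftNbhd.2 ⟨u, h hu, huv⟩

lemma exists_card_leftNbhd_lt_of_not_hasHamiltonianDecomposition {E : Finset (Fin m × Fin m)}
    (h : ¬HasHamiltonianDecomposition m E) : ∃ A, #(leftNbhd m E A) < #A := by
  by_contra! hA
  have h1 : ∀ A : Finset (Fin m), #A ≤ #(A.biUnion fun u => leftNbhd m E {u}) := fun A => by
    refine (hA A).trans (Finset.card_le_card fun v hv => ?_)
    obtain ⟨u, hu, huv⟩ := mem_leftNbhd.1 hv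
    exact Finset.mem_biUnion.2 ⟨u, hu, mem_leftNbhd.2 ⟨u, by simp, huv⟩⟩
  obtain ⟨f, hf, hfE⟩ := (Finset.all_card_le_biUnion_card_iff_exists_injective _).1 h1
  refine h ⟨Equiv.ofBijective f (Finite.injective_iff_bijective.1 hf), fun u => ?_⟩
  simpa [mem_leftNbhd] using hfE u

/-- A set `A` of `j + 2` left vertices whose neighbours lie in a
set `B` of `j + 1` right vertices, each of which has at least two neighbours in `A`. -/
def HallObstruction (m : ℕ) (E : Finset (Fin m × Fin m)) (j : ℕ) (A B : Finset (Fin m)) : Prop :=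
  #A = j + 2 ∧ #B = j + 1 ∧ (∀ a ∈ A, ∀ b ∉ B, (a, b) ∉ E) ∧
    ∀ b ∈ B, ∃ a ∈ A, ∃ a' ∈ A, a ≠ a' ∧ (a, b) ∈ E ∧ (a', b) ∈ E

lemma exists_hallObstruction_of_minimal {E : Finset (Fin m × Fin m)}
    {A : Finset (Fin m)} (hA : #(leftNbhd m E A) < #A)
    (hminl : ∀ J, #(leftNbhd m E J) < #J → #A ≤ #J)
    (hminr : ∀ J, #(rightNbhd m E J) < #J → #A ≤ #J)
    (hdeg : ∀ u, ∃ v, (u, v) ∈ E) :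
    ∃ j, 2 * (j + 2) ≤ m + 1 ∧ ∃ A B, HallObstruction m E j A B := by
  obtain ⟨a₀, ha₀⟩ : A.Nonempty := Finset.card_pos.1 (by omega)
  have herase : ∀ a ∈ A, #A - 1 ≤ #(leftNbhd m E (A.erase a)) := fun a ha => by
    by_contra! h
    have h1 := Finset.card_erase_of_mem ha
    have := hminl (A.erase a) (by omega)
    have := Finset.card_pos.2 ⟨a, ha⟩
    omega
  have hcard : #(leftNbhd m E A) + 1 = #A := by
    have h1 := herase a₀ ha₀
    have h2 := Finset.card_le_card (leftNbhd_mono (E := E) (Finset.erase_subset a₀ A))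
    omega
  obtain ⟨b₀, hb₀⟩ := hdeg a₀
  have hNpos : 0 < #(leftNbhd m E A) := Finset.card_pos.2 ⟨b₀, mem_leftNbhd.2 ⟨a₀, ha₀, hb₀⟩⟩
  have hcompl : #A ≤ #(leftNbhd m E A)ᶜ := by
    apply hminr
    have hsub : rightNbhd m E (leftNbhd m E A)ᶜ ⊆ Aᶜ := fun u hu => by
      obtain ⟨v, hv, huv⟩ := mem_rightNbhd.1 hu
      exact Finset.mem_compl.2 fun huA =>
        Finset.mem_compl.1 hv (mem_leftNbhd.2 ⟨u, huA, huv⟩)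
    have h1 := Finset.card_le_card hsub
    have h2 := Finset.card_compl_add_card A
    have h3 := Finset.card_compl_add_card (leftNbhd m E A)
    omega
  have h3 := Finset.card_compl_add_card (leftNbhd m E A)
  rw [Fintype.card_fin] at h3
  refine ⟨#A - 2, by omega, A, leftNbhd m E A, by omega, by omega,
    fun a ha b hb hab => hb (mem_leftNbhd.2 ⟨a, ha, hab⟩), fun b hb => ?_⟩
  obtain ⟨a, ha, hab⟩ := mem_leftNbhd.1 hb
  refine ⟨a, ha, ?_⟩
  by_contra! h
  have hsub : leftNbhd m E (A.erase a) ⊆ (leftNbhd m E A).erase b := fun v hv => by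
    obtain ⟨u, hu, huv⟩ := mem_leftNbhd.1 hv
    obtain ⟨hua, huA⟩ := Finset.mem_erase.1 hu
    refine Finset.mem_erase.2 ⟨?_, mem_leftNbhd.2 ⟨u, huA, huv⟩⟩
    rintro rfl
    exact h u huA hua.symm hab huv
  have h4 := Finset.card_le_card hsub
  rw [Finset.card_erase_of_mem hb] at h4
  have h5 := herase a ha
  omega

lemma exists_hallObstruction {E : Finset (Fin m × Fin m)}
    (h : ¬HasHamiltonianDecomposition m E)
    (hl : ∀ u, ∃ v, (u, v) ∈ E) (hr : ∀ v, ∃ u, (u, v) ∈ E) :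
    (∃ j, 2 * (j + 2) ≤ m + 1 ∧ ∃ A B, HallObstruction m E j A B) ∨
      ∃ j, 2 * (j + 2) ≤ m + 1 ∧ ∃ A B, HallObstruction m (reverseEdges E) j A B := by
  classical
  obtain ⟨A₀, hA₀⟩ := exists_card_leftNbhd_lt_of_not_hasHamiltonianDecomposition h
  obtain ⟨A, hA, hmin⟩ := Finset.exists_min_image
    (univ.filter fun A => #(leftNbhd m E A) < #A ∨ #(rightNbhd m E A) < #A) Finset.card
    ⟨A₀, by simp [hA₀]⟩
  simp only [Finset.mem_filter, Finset.mem_univ, true_and] at hA hmin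
  rcases hA with hA | hA
  · exact .inl (exists_hallObstruction_of_minimal hA (fun J hJ => hmin J (.inl hJ))
      (fun J hJ => hmin J (.inr hJ)) hl)
  · refine .inr (exists_hallObstruction_of_minimal (A := A) (by rwa [leftNbhd_reverseEdges])
      (fun J hJ => hmin J (.inr (by rwa [leftNbhd_reverseEdges] at hJ)))
      (fun J hJ => hmin J (.inl ?_)) fun v => ?_)
    · rwa [← leftNbhd_reverseEdges, reverseEdges_reverseEdges] at hJ
    · simpa only [mem_reverseEdges] using hr v

end Hall

section MatchingProbability

variable {m : ℕ} {p : ℝ}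

lemma bernoulliProb_hallObstruction_le (hp : p ∈ Set.Icc (0 : ℝ) 1) {j : ℕ}
    {A B : Finset (Fin m)} (hA : #A = j + 2) (hB : #B = j + 1) :
    bernoulliProb p (fun E => HallObstruction m E j A B) ≤
      ((j + 2 : ℝ) ^ 2 * p ^ 2) ^ (j + 1) * (1 - p) ^ ((j + 2) * (m - (j + 1))) := by
  classical
  let T : (B → Fin m × Fin m) → Finset (Fin m × Fin m) := fun h =>
    (univ : Finset (B × Bool)).image fun x =>
      (if x.2 then (h x.1).1 else (h x.1).2, (x.1 : Fin m))
  let F : Finset (B → Fin m × Fin m) := Fintype.piFinset fun _ => A.offDiag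
  have hF : (#F : ℝ) ≤ ((j + 2 : ℝ) ^ 2) ^ (j + 1) := by
    have h1 : #F = #A.offDiag ^ #B := by simp [F]
    have h2 : #A.offDiag ≤ (j + 2) ^ 2 := by
      rw [Finset.offDiag_card, hA]
      exact (Nat.sub_le _ _).trans (by rw [sq])
    rw [h1, hB]
    exact_mod_cast Nat.pow_le_pow_left h2 _
  have hT : ∀ h ∈ F, #(T h) = 2 * (j + 1) := fun h hh => by
    rw [Finset.card_image_of_injective, Finset.card_univ, Fintype.card_prod, Fintype.card_coe,
      Fintype.card_bool, hB, mul_comm]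
    rintro ⟨b, i⟩ ⟨b', i'⟩ hbb
    simp only [Prod.mk.injEq] at hbb
    obtain rfl : b = b' := Subtype.ext hbb.2
    have := (Finset.mem_offDiag.1 (Fintype.mem_piFinset.1 hh b)).2.2
    cases i <;> cases i' <;> simp_all [eq_comm]
  have hS : #(A ×ˢ Bᶜ) = (j + 2) * (m - (j + 1)) := by
    rw [Finset.card_product, Finset.card_compl, hA, hB, Fintype.card_fin]
  have hdisj : ∀ h, Disjoint (A ×ˢ Bᶜ) (T h) := fun h => by
    rw [Finset.disjoint_left]
    rintro ⟨a, b⟩ hab habT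
    obtain ⟨x, -, hx⟩ := Finset.mem_image.1 habT
    have hb : b = x.1 := (congrArg Prod.snd hx).symm
    exact Finset.mem_compl.1 (Finset.mem_product.1 hab).2 (hb ▸ x.1.2)
  calc bernoulliProb p (fun E => HallObstruction m E j A B)
      ≤ bernoulliProb p (fun E => ∃ h ∈ F, T h ⊆ E ∧ Disjoint (A ×ˢ Bᶜ) E) := by
        refine bernoulliProb_mono hp ?_
        rintro E ⟨-, -, hE, hE'⟩
        choose f hf f' hf' hne hfE hfE' using hE'
        refine ⟨fun b => (f b b.2, f' b b.2), Fintype.mem_piFinset.2 fun b =>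
          Finset.mem_offDiag.2 ⟨hf b b.2, hf' b b.2, hne b b.2⟩, ?_, ?_⟩
        · intro e he
          obtain ⟨⟨b, i⟩, -, rfl⟩ := Finset.mem_image.1 he
          cases i
          · simpa using hfE' b b.2
          · simpa using hfE b b.2
        · rw [Finset.disjoint_left]
          rintro ⟨a, b⟩ hab
          obtain ⟨ha, hb⟩ := Finset.mem_product.1 hab
          exact hE a ha b (Finset.mem_compl.1 hb)
    _ ≤ ∑ h ∈ F, bernoulliProb p (fun E => T h ⊆ E ∧ Disjoint (A ×ˢ Bᶜ) E) :=
        bernoulliProb_exists_le hp _ _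
    _ = ∑ h ∈ F, p ^ (2 * (j + 1)) * (1 - p) ^ ((j + 2) * (m - (j + 1))) :=
        Finset.sum_congr rfl fun h hh => by
          rw [bernoulliProb_subset_disjoint p (hdisj h), hT h hh, hS]
    _ = #F * (p ^ (2 * (j + 1)) * (1 - p) ^ ((j + 2) * (m - (j + 1)))) := by simp
    _ ≤ ((j + 2 : ℝ) ^ 2) ^ (j + 1) *
          (p ^ (2 * (j + 1)) * (1 - p) ^ ((j + 2) * (m - (j + 1)))) :=
        mul_le_mul_of_nonneg_right hF
          (mul_nonneg (pow_nonneg hp.1 _) (pow_nonneg (sub_nonneg.2 hp.2) _))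
    _ = _ := by rw [mul_pow, ← pow_mul p]; ring

lemma bernoulliProb_exists_hallObstruction_le (hp : p ∈ Set.Icc (0 : ℝ) 1) (m : ℕ) :
    bernoulliProb p (fun E => ∃ j, 2 * (j + 2) ≤ m + 1 ∧ ∃ A B, HallObstruction m E j A B) ≤
      ∑ j ∈ range m with 2 * (j + 2) ≤ m + 1, m.choose (j + 2) * m.choose (j + 1) *
        (((j + 2 : ℝ) ^ 2 * p ^ 2) ^ (j + 1) * (1 - p) ^ ((j + 2) * (m - (j + 1)))) := by
  classical
  let P : ℕ → Finset (Finset (Fin m) × Finset (Fin m)) := fun j =>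
    powersetCard (j + 2) univ ×ˢ powersetCard (j + 1) univ
  calc _ ≤ bernoulliProb p (fun E => ∃ j ∈ (range m).filter fun j => 2 * (j + 2) ≤ m + 1,
        ∃ x ∈ P j, HallObstruction m E j x.1 x.2) := by
        refine bernoulliProb_mono hp ?_
        rintro E ⟨j, hj, A, B, h⟩
        refine ⟨j, by simp; omega, (A, B), ?_, h⟩
        simp [P, Finset.mem_powersetCard, h.1, h.2.1]
    _ ≤ ∑ j ∈ range m with 2 * (j + 2) ≤ m + 1,
        bernoulliProb p (fun E => ∃ x ∈ P j, HallObstruction m E j x.1 x.2) :=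
        bernoulliProb_exists_le hp _ _
    _ ≤ _ := by
        refine Finset.sum_le_sum fun j _ => (bernoulliProb_exists_le hp _ _).trans ?_
        refine (Finset.sum_le_sum fun x hx => bernoulliProb_hallObstruction_le hp
          (Finset.mem_powersetCard.1 (Finset.mem_product.1 hx).1).2
          (Finset.mem_powersetCard.1 (Finset.mem_product.1 hx).2).2).trans ?_
        simp

lemma le_bernoulliProb_hasHamiltonianDecomposition (hp : p ∈ Set.Icc (0 : ℝ) 1) (m : ℕ) :
    (1 - (1 - p) ^ m) ^ (2 * m) -
      2 * bernoulliProb p (fun E => ∃ j, 2 * (j + 2) ≤ m + 1 ∧ ∃ A B, HallObstruction m E j A B)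
      ≤ bernoulliProb p (HasHamiltonianDecomposition m) := by
  classical
  let L : Fin m ⊕ Fin m → Finset (Fin m × Fin m) :=
    Sum.elim (fun u => {u} ×ˢ univ) (fun v => univ ×ˢ {v})
  have hL : ∀ k, #(L k) = m := by rintro (u | v) <;> simp [L]
  have h1 : (1 - (1 - p) ^ m) ^ (2 * m) ≤
      bernoulliProb p (fun E => ∀ k ∈ (univ : Finset (Fin m ⊕ Fin m)), ¬Disjoint (L k) E) := by
    refine le_trans (le_of_eq ?_) (prod_le_bernoulliProb_forall hp univ
      (Q := fun k E => ¬Disjoint (L k) E)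
      fun k E F hEF h hF => h (Finset.disjoint_of_subset_right hEF hF))
    simp [bernoulliProb_not_disjoint, hL, two_mul]
  let O : Finset (Fin m × Fin m) → Prop := fun E =>
    ∃ j, 2 * (j + 2) ≤ m + 1 ∧ ∃ A B, HallObstruction m E j A B
  have h2 : bernoulliProb p (fun E => ∀ k ∈ (univ : Finset (Fin m ⊕ Fin m)), ¬Disjoint (L k) E)
      ≤ bernoulliProb p (fun E => HasHamiltonianDecomposition m E ∨ O E ∨ O (reverseEdges E)) := by
    refine bernoulliProb_mono hp fun E hE => ?_
    by_cases hH : HasHamiltonianDecomposition m E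
    · exact .inl hH
    refine .inr (exists_hallObstruction hH (fun u => ?_) fun v => ?_)
    · obtain ⟨⟨a, b⟩, ha, hb⟩ := Finset.not_disjoint_iff.1 (hE (.inl u) (by simp))
      obtain rfl : u = a := by simpa [L] using ha
      exact ⟨b, hb⟩
    · obtain ⟨⟨a, b⟩, ha, hb⟩ := Finset.not_disjoint_iff.1 (hE (.inr v) (by simp))
      obtain rfl : v = b := by simpa [L] using ha
      exact ⟨a, hb⟩
  have h3 := bernoulliProb_or_le hp (HasHamiltonianDecomposition m)
    (fun E => O E ∨ O (reverseEdges E))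
  have h4 := bernoulliProb_or_le hp O (fun E => O (reverseEdges E))
  have h5 : bernoulliProb p (fun E => O (reverseEdges E)) = bernoulliProb p O :=
    bernoulliProb_comp_map (Equiv.prodComm _ _) p O
  change _ - 2 * bernoulliProb p O ≤ _
  linarith

end MatchingProbability

section DeletedVertices

variable {m : ℕ}

/-- The edges of `Fin (m + 1)` avoiding the left vertex `u` and the right vertex `v`. -/
def avoidingEmb (u v : Fin (m + 1)) : Fin m × Fin m ↪ Fin (m + 1) × Fin (m + 1) :=
  u.succAboveEmb.prodMap v.succAboveEmb

lemma fst_ne_of_mem_map_avoidingEmb {u v : Fin (m + 1)} {E : Finset (Fin m × Fin m)}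
    {e : Fin (m + 1) × Fin (m + 1)} (he : e ∈ E.map (avoidingEmb u v)) : e.1 ≠ u := by
  obtain ⟨x, -, rfl⟩ := Finset.mem_map.1 he
  exact Fin.succAbove_ne u x.1

lemma snd_ne_of_mem_map_avoidingEmb {u v : Fin (m + 1)} {E : Finset (Fin m × Fin m)}
    {e : Fin (m + 1) × Fin (m + 1)} (he : e ∈ E.map (avoidingEmb u v)) : e.2 ≠ v := by
  obtain ⟨x, -, rfl⟩ := Finset.mem_map.1 he
  exact Fin.succAbove_ne v x.2

lemma exists_mem_map_avoidingEmb_of_ne_fst {u v a : Fin (m + 1)} {E : Finset (Fin m × Fin m)}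
    (hE : HasHamiltonianDecomposition m E) (ha : a ≠ u) :
    ∃ b, (a, b) ∈ E.map (avoidingEmb u v) := by
  obtain ⟨σ, hσ⟩ := hE
  obtain ⟨i, rfl⟩ := Fin.exists_succAbove_eq ha
  exact ⟨v.succAbove (σ i), Finset.mem_map.2 ⟨(i, σ i), hσ i, rfl⟩⟩

lemma exists_mem_map_avoidingEmb_of_ne_snd {u v b : Fin (m + 1)} {E : Finset (Fin m × Fin m)}
    (hE : HasHamiltonianDecomposition m E) (hb : b ≠ v) :
    ∃ a, (a, b) ∈ E.map (avoidingEmb u v) := by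
  obtain ⟨σ, hσ⟩ := hE
  obtain ⟨i, rfl⟩ := Fin.exists_succAbove_eq hb
  refine ⟨u.succAbove (σ.symm i), Finset.mem_map.2 ⟨(σ.symm i, i), ?_, rfl⟩⟩
  simpa using hσ (σ.symm i)

lemma eq_of_map_avoidingEmb_eq {u v u' v' : Fin (m + 1)} {E E' : Finset (Fin m × Fin m)}
    (hE' : HasHamiltonianDecomposition m E')
    (h : E.map (avoidingEmb u v) = E'.map (avoidingEmb u' v')) : u = u' ∧ v = v' ∧ E = E' := by
  obtain rfl : u = u' := by
    by_contra hu
    obtain ⟨b, hb⟩ := exists_mem_map_avoidingEmb_of_ne_fst (v := v') hE' hu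
    exact fst_ne_of_mem_map_avoidingEmb (h.symm.subset hb) rfl
  obtain rfl : v = v' := by
    by_contra hv
    obtain ⟨a, ha⟩ := exists_mem_map_avoidingEmb_of_ne_snd (u := u) hE' hv
    exact snd_ne_of_mem_map_avoidingEmb (h.symm.subset ha) rfl
  exact ⟨rfl, rfl, Finset.map_injective _ h⟩

lemma not_structurallyDiagonalizable_map_avoidingEmb {u v : Fin (m + 1)} (huv : u ≠ v)
    {E : Finset (Fin m × Fin m)} (hE : HasHamiltonianDecomposition m E) :
    ¬StructurallyDiagonalizable (m + 1) (E.map (avoidingEmb u v)) := by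
  classical
  rintro ⟨M, ⟨hME, -, hmax⟩, τ, S, hS, rfl⟩
  obtain ⟨σ, hσ⟩ := hE
  have hedge : ∀ w ∈ S, (w, τ w) ∈ E.map (avoidingEmb u v) := fun w hw =>
    hME (Finset.mem_image_of_mem _ hw)
  have hu : u ∉ S := fun h => fst_ne_of_mem_map_avoidingEmb (hedge u h) rfl
  have himage : S.image τ = S := Finset.eq_of_subset_of_card_le
    (Finset.image_subset_iff.2 hS) (Finset.card_image_of_injective S τ.injective).ge
  have hv : v ∉ S := fun h => by
    obtain ⟨w, hw, hwv⟩ := Finset.mem_image.1 (himage.symm ▸ h)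
    exact snd_ne_of_mem_map_avoidingEmb (hedge w hw) hwv
  have hcard : #S + 2 ≤ m + 1 := by
    have h1 : #({u, v} : Finset (Fin (m + 1))) = 2 := Finset.card_pair huv
    have h2 : Disjoint S {u, v} := by simp [hu, hv]
    rw [← h1, ← Finset.card_union_of_disjoint h2]
    simpa using Finset.card_le_univ (S ∪ {u, v})
  have hM := hmax ((univ.image fun i => (i, σ i)).map (avoidingEmb u v))
    (Finset.map_subset_map.2 (Finset.image_subset_iff.2 fun i _ => hσ i)) (by
      intro e he f hf hef
      simp only [Finset.mem_map, Finset.mem_image, Finset.mem_univ, true_and,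
        exists_exists_eq_and] at he hf
      obtain ⟨i, rfl⟩ := he
      obtain ⟨j, rfl⟩ := hf
      have : i = j := by
        rcases hef with h | h
        · exact Fin.succAbove_right_injective h
        · exact σ.injective (Fin.succAbove_right_injective h)
      rw [this])
  rw [Finset.card_map, Finset.card_image_of_injective _ fun i j h => congrArg Prod.fst h,
    Finset.card_univ, Fintype.card_fin] at hM
  have := hM.trans Finset.card_image_le
  omega

lemma le_bernoulliProb_not_structurallyDiagonalizable {p : ℝ} (hp : p ∈ Set.Icc (0 : ℝ) 1) :
    (m + 1) * m * (1 - p) ^ (2 * m + 1) * bernoulliProb p (HasHamiltonianDecomposition m) ≤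
      bernoulliProb p (fun E => ¬StructurallyDiagonalizable (m + 1) E) := by
  classical
  let Φ : (Fin (m + 1) × Fin (m + 1)) × Finset (Fin m × Fin m) →
      Finset (Fin (m + 1) × Fin (m + 1)) := fun x => x.2.map (avoidingEmb x.1.1 x.1.2)
  let I : Finset ((Fin (m + 1) × Fin (m + 1)) × Finset (Fin m × Fin m)) :=
    univ.offDiag ×ˢ univ.filter (HasHamiltonianDecomposition m)
  have hI : ∀ x ∈ I, x.1.1 ≠ x.1.2 ∧ HasHamiltonianDecomposition m x.2 := fun x hx => by
    simpa [I] using hx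
  have hinj : Set.InjOn Φ I := fun x hx y hy hxy => by
    obtain ⟨h1, h2, h3⟩ := eq_of_map_avoidingEmb_eq (hI y hy).2 hxy
    exact Prod.ext (Prod.ext h1 h2) h3
  have hsub : I.image Φ ⊆ univ.filter fun E => ¬StructurallyDiagonalizable (m + 1) E :=
    Finset.image_subset_iff.2 fun x hx => Finset.mem_filter.2 ⟨Finset.mem_univ _,
      not_structurallyDiagonalizable_map_avoidingEmb (hI x hx).1 (hI x hx).2⟩
  have hexp : (m + 1) * (m + 1) - m * m = 2 * m + 1 := by
    rw [Nat.sub_eq_iff_eq_add (by nlinarith)]; ring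
  have hpairs : ((m + 1) * (m + 1) - (m + 1) : ℕ) = (m + 1) * m := by
    rw [Nat.sub_eq_iff_eq_add (by nlinarith)]; ring
  calc _ = ∑ x ∈ I, bernoulliWeight p (Φ x) := by
        simp only [I, Φ, bernoulliWeight_map, Finset.sum_product, Fintype.card_prod,
          Fintype.card_fin, hexp, ← Finset.mul_sum, Finset.sum_const, Finset.offDiag_card,
          Finset.card_univ, hpairs, nsmul_eq_mul, bernoulliProb]
        push_cast
        ring
    _ = ∑ E ∈ I.image Φ, bernoulliWeight p E := (Finset.sum_image hinj).symm
    _ ≤ ∑ E with ¬StructurallyDiagonalizable (m + 1) E, bernoulliWeight p E :=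
        Finset.sum_le_sum_of_subset_of_nonneg hsub fun E _ _ => bernoulliWeight_nonneg hp E
    _ = _ := by
        rw [bernoulliProb]
        congr!

lemma digraphProb_eq_bernoulliProb (n : ℕ) (p : ℝ) (Q : Finset (Fin n × Fin n) → Prop) :
    digraphProb n p p {E | Q E} = bernoulliProb p Q := by
  classical
  simp only [digraphProb, bernoulliProb, Finset.sum_filter, Set.indicator_apply,
    Set.mem_ofPred_eq, ite_self, Finset.prod_const, bernoulliWeight,
    ← Finset.compl_eq_univ_sdiff]

end DeletedVertices

section Asymptotics

open Topology

lemma choose_mul_choose_mul_pow_le (m j : ℕ) :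
    (m.choose (j + 2) * m.choose (j + 1) * ((j + 2 : ℝ) ^ 2) ^ (j + 1) : ℝ) ≤
      m ^ (2 * j + 3) * Real.exp (j + 2) ^ 2 := by
  have hk : (0 : ℝ) < (j + 2).factorial := by positivity
  have h1 : (m.choose (j + 2) : ℝ) ≤ m ^ (j + 2) / (j + 2).factorial := Nat.choose_le_pow_div _ _
  have h2 : (m.choose (j + 1) : ℝ) ≤ (j + 2) * m ^ (j + 1) / (j + 2).factorial := by
    refine (Nat.choose_le_pow_div _ _).trans (le_of_eq ?_)
    rw [Nat.factorial_succ (j + 1)]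
    push_cast
    field_simp
    ring
  have h3 : (j + 2 : ℝ) ^ (j + 2) / (j + 2).factorial ≤ Real.exp (j + 2) :=
    Real.pow_div_factorial_le_exp _ (by positivity) _
  calc (m.choose (j + 2) * m.choose (j + 1) * ((j + 2 : ℝ) ^ 2) ^ (j + 1) : ℝ)
      ≤ (m ^ (j + 2) / (j + 2).factorial) * ((j + 2) * m ^ (j + 1) / (j + 2).factorial) *
          ((j + 2 : ℝ) ^ 2) ^ (j + 1) := by gcongr
    _ = m ^ (2 * j + 3) * ((j + 2 : ℝ) ^ (j + 2) / (j + 2).factorial) ^ 2 / (j + 2) := by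
        rw [← pow_mul (j + 2 : ℝ)]
        field_simp
        ring
    _ ≤ m ^ (2 * j + 3) * ((j + 2 : ℝ) ^ (j + 2) / (j + 2).factorial) ^ 2 :=
        div_le_self (by positivity) (by linarith [(Nat.cast_nonneg j : (0 : ℝ) ≤ j)])
    _ ≤ _ := by gcongr

lemma one_sub_pow_le_exp {p : ℝ} (hp : p ∈ Set.Icc (0 : ℝ) 1) {m j : ℕ}
    (hj : 2 * (j + 2) ≤ m + 1) :
    (1 - p) ^ ((j + 2) * (m - (j + 1))) ≤
      Real.exp (-(5 / 4 * (m * p))) * Real.exp (-(1 / 4 * (m * p))) ^ j := by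
  have h1 : (1 - p) ^ ((j + 2) * (m - (j + 1))) ≤
      Real.exp (-p) ^ ((j + 2) * (m - (j + 1))) :=
    pow_le_pow_left₀ (sub_nonneg.2 hp.2) (Real.one_sub_le_exp_neg p) _
  refine h1.trans ?_
  rw [← Real.exp_nat_mul, ← Real.exp_nat_mul, ← Real.exp_add, Real.exp_le_exp]
  have hle : j + 1 ≤ m := by omega
  have hj' : 2 * ((j : ℝ) + 2) ≤ m + 1 := by exact_mod_cast hj
  have hj0 : (0 : ℝ) ≤ j := Nat.cast_nonneg j
  push_cast [Nat.cast_sub hle]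
  have key : (5 + j) / 4 * (m : ℝ) ≤ (j + 2) * (m - (j + 1)) := by
    nlinarith [mul_nonneg (by linarith : (0 : ℝ) ≤ j + 1)
      (by linarith : (0 : ℝ) ≤ 3 * m / 4 - j - 2)]
  nlinarith [mul_le_mul_of_nonneg_left key hp.1]

lemma hallObstruction_term_le {p : ℝ} (hp : p ∈ Set.Icc (0 : ℝ) 1) {m j : ℕ}
    (hj : 2 * (j + 2) ≤ m + 1) :
    m.choose (j + 2) * m.choose (j + 1) *
        (((j + 2 : ℝ) ^ 2 * p ^ 2) ^ (j + 1) * (1 - p) ^ ((j + 2) * (m - (j + 1)))) ≤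
      m * (m * p) ^ 2 * Real.exp 4 * Real.exp (-(5 / 4 * (m * p))) *
        ((m * p) ^ 2 * Real.exp 2 * Real.exp (-(1 / 4 * (m * p)))) ^ j := by
  have hp0 := hp.1
  have hq0 : 0 ≤ 1 - p := sub_nonneg.2 hp.2
  calc _ = (m.choose (j + 2) * m.choose (j + 1) * ((j + 2 : ℝ) ^ 2) ^ (j + 1)) *
        (p ^ (2 * j + 2) * (1 - p) ^ ((j + 2) * (m - (j + 1)))) := by
        rw [mul_pow _ (p ^ 2), ← pow_mul p]
        ring
    _ ≤ (m ^ (2 * j + 3) * Real.exp (j + 2) ^ 2) * (p ^ (2 * j + 2) *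
        (Real.exp (-(5 / 4 * (m * p))) * Real.exp (-(1 / 4 * (m * p))) ^ j)) := by
        refine mul_le_mul (choose_mul_choose_mul_pow_le m j) ?_ (by positivity) (by positivity)
        exact mul_le_mul_of_nonneg_left (one_sub_pow_le_exp hp hj) (by positivity)
    _ = _ := by
        have : Real.exp (j + 2) ^ 2 = Real.exp 4 * Real.exp 2 ^ j := by
          rw [← Real.exp_nat_mul, ← Real.exp_nat_mul, ← Real.exp_add]
          congr 1
          push_cast
          ring
        rw [this]
        ring

lemma bernoulliProb_exists_hallObstruction_le_of_le_half {p : ℝ} (hp : p ∈ Set.Icc (0 : ℝ) 1)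
    {m : ℕ} (hm : (m * p) ^ 2 * Real.exp 2 * Real.exp (-(1 / 4 * (m * p))) ≤ 1 / 2) :
    bernoulliProb p (fun E => ∃ j, 2 * (j + 2) ≤ m + 1 ∧ ∃ A B, HallObstruction m E j A B) ≤
      2 * (m * (m * p) ^ 2 * Real.exp 4 * Real.exp (-(5 / 4 * (m * p)))) := by
  have hp0 := hp.1
  set K := m * (m * p) ^ 2 * Real.exp 4 * Real.exp (-(5 / 4 * (m * p))) with hK
  have hK0 : 0 ≤ K := by positivity
  calc _ ≤ _ := bernoulliProb_exists_hallObstruction_le hp m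
    _ ≤ ∑ j ∈ range m with 2 * (j + 2) ≤ m + 1, K * (1 / 2) ^ j := by
        refine Finset.sum_le_sum fun j hj =>
          (hallObstruction_term_le hp (Finset.mem_filter.1 hj).2).trans ?_
        gcongr
    _ ≤ ∑ j ∈ range m, K * (1 / 2) ^ j :=
        Finset.sum_le_sum_of_subset_of_nonneg (Finset.filter_subset _ _)
          fun j _ _ => by positivity
    _ = K * ∑ j ∈ range m, (1 / 2) ^ j := by rw [Finset.mul_sum]
    _ ≤ K * 2 := by gcongr; exact sum_geometric_two_le m
    _ = 2 * K := mul_comm _ _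

variable {c : ℝ} {q : ℕ → ℝ}

lemma tendsto_natCast_mul_atTop
    (hlim : Tendsto (fun m : ℕ => (m : ℝ) * q m - Real.log m) atTop (𝓝 c)) :
    Tendsto (fun m : ℕ => (m : ℝ) * q m) atTop atTop := by
  simpa using hlim.add_atTop (Real.tendsto_log_atTop.comp tendsto_natCast_atTop_atTop)

lemma tendsto_zero_of_tendsto_mul_sub_log
    (hlim : Tendsto (fun m : ℕ => (m : ℝ) * q m - Real.log m) atTop (𝓝 c)) :
    Tendsto q atTop (𝓝 0) := by
  have h1 := hlim.mul tendsto_inv_atTop_nhds_zero_nat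
  have h2 : Tendsto (fun m : ℕ => Real.log m / m) atTop (𝓝 0) := by
    simpa [Function.comp_def] using
      (Real.tendsto_pow_log_div_mul_add_atTop 1 0 1 one_ne_zero).comp tendsto_natCast_atTop_atTop
  have h3 := h1.add h2
  simp only [mul_zero, add_zero] at h3
  refine h3.congr' ?_
  filter_upwards [eventually_ne_atTop 0] with m hm
  field_simp
  ring

lemma tendsto_natCast_mul_exp_neg
    (hlim : Tendsto (fun m : ℕ => (m : ℝ) * q m - Real.log m) atTop (𝓝 c)) :
    Tendsto (fun m : ℕ => m * Real.exp (-(m * q m))) atTop (𝓝 (Real.exp (-c))) := by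
  refine ((Real.continuous_exp.tendsto _).comp hlim.neg).congr' ?_
  filter_upwards [eventually_gt_atTop 0] with m hm
  have hm' : (0 : ℝ) < m := Nat.cast_pos.2 hm
  rw [Function.comp_apply, neg_sub, sub_eq_add_neg, Real.exp_add, Real.exp_log hm']

lemma tendsto_natCast_mul_one_sub_pow (hq : ∀ m, q m ∈ Set.Icc (0 : ℝ) 1)
    (hlim : Tendsto (fun m : ℕ => (m : ℝ) * q m - Real.log m) atTop (𝓝 c)) :
    Tendsto (fun m : ℕ => m * (1 - q m) ^ m) atTop (𝓝 (Real.exp (-c))) := by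
  have hexp := tendsto_natCast_mul_exp_neg hlim
  have hsq : Tendsto (fun m : ℕ => m * q m ^ 2) atTop (𝓝 0) := by
    have h1 := ((Real.tendsto_pow_mul_exp_neg_atTop_nhds_zero 2).comp
      (tendsto_natCast_mul_atTop hlim)).div hexp (Real.exp_ne_zero _)
    rw [zero_div] at h1
    refine h1.congr' ?_
    filter_upwards [eventually_ne_atTop 0] with m hm
    have hm' : (m : ℝ) ≠ 0 := Nat.cast_ne_zero.2 hm
    simp only [Pi.div_apply, Function.comp_apply]
    field_simp
  have hratio : Tendsto (fun m : ℕ => ((1 - q m) * Real.exp (q m)) ^ m) atTop (𝓝 1) := by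
    refine tendsto_of_tendsto_of_tendsto_of_le_of_le' (g := fun m : ℕ => 1 - m * q m ^ 2)
      (by simpa using hsq.const_sub 1) tendsto_const_nhds ?_ ?_
    · filter_upwards with m
      have h0 := (hq m).1
      have h1 := (hq m).2
      have h2 : q m ^ 2 ≤ 1 := pow_le_one₀ h0 h1
      have h3 : 1 + -q m ^ 2 ≤ (1 - q m) * Real.exp (q m) := by
        nlinarith [Real.add_one_le_exp (q m)]
      have h4 := one_add_mul_le_pow (a := -q m ^ 2) (by linarith) m
      calc 1 - m * q m ^ 2 = 1 + m * -q m ^ 2 := by ring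
        _ ≤ _ := h4
        _ ≤ _ := pow_le_pow_left₀ (by linarith) h3 m
    · filter_upwards with m
      refine pow_le_one₀ (mul_nonneg (sub_nonneg.2 (hq m).2) (Real.exp_nonneg _)) ?_
      calc _ ≤ Real.exp (-q m) * Real.exp (q m) := by
            gcongr
            exact Real.one_sub_le_exp_neg _
        _ = 1 := by rw [← Real.exp_add]; simp
  have h := hexp.mul hratio
  rw [mul_one] at h
  refine h.congr fun m => ?_
  rw [mul_pow, ← Real.exp_nat_mul, mul_assoc, mul_left_comm (Real.exp _), ← Real.exp_add]
  simp

lemma tendsto_sq_mul_exp_neg_quarter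
    (hlim : Tendsto (fun m : ℕ => (m : ℝ) * q m - Real.log m) atTop (𝓝 c)) :
    Tendsto (fun m : ℕ => (m * q m) ^ 2 * Real.exp (-(1 / 4 * (m * q m)))) atTop (𝓝 0) := by
  have h := (((Real.tendsto_pow_mul_exp_neg_atTop_nhds_zero 2).comp
    ((tendsto_natCast_mul_atTop hlim).const_mul_atTop (by norm_num : (0 : ℝ) < 1 / 4)))).const_mul
    16
  rw [mul_zero] at h
  refine h.congr fun m => ?_
  simp only [Function.comp_apply]
  ring

lemma tendsto_hallObstruction_bound
    (hlim : Tendsto (fun m : ℕ => (m : ℝ) * q m - Real.log m) atTop (𝓝 c)) :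
    Tendsto (fun m : ℕ => m * (m * q m) ^ 2 * Real.exp 4 * Real.exp (-(5 / 4 * (m * q m))))
      atTop (𝓝 0) := by
  have h := ((tendsto_natCast_mul_exp_neg hlim).mul
    (tendsto_sq_mul_exp_neg_quarter hlim)).mul_const (Real.exp 4)
  rw [mul_zero, zero_mul] at h
  refine h.congr fun m => ?_
  have : Real.exp (-(5 / 4 * (m * q m))) =
      Real.exp (-(m * q m)) * Real.exp (-(1 / 4 * (m * q m))) := by
    rw [← Real.exp_add]
    ring_nf
  rw [this]
  ring

lemma tendsto_one_sub_one_sub_pow_pow (hq : ∀ m, q m ∈ Set.Icc (0 : ℝ) 1)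
    (hlim : Tendsto (fun m : ℕ => (m : ℝ) * q m - Real.log m) atTop (𝓝 c)) :
    Tendsto (fun m : ℕ => (1 - (1 - q m) ^ m) ^ (2 * m)) atTop
      (𝓝 (Real.exp (-(2 * Real.exp (-c))))) := by
  have h := (Real.tendsto_one_add_pow_exp_of_tendsto (g := fun m => -(1 - q m) ^ m)
    (t := -Real.exp (-c))
    (by simpa using (tendsto_natCast_mul_one_sub_pow hq hlim).neg)).pow 2
  rw [← Real.exp_nat_mul] at h
  convert h using 2 with m
  · rw [← pow_mul, mul_comm 2 m, sub_eq_add_neg]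
  · push_cast
    ring_nf

lemma tendsto_mul_sub_log_succ {p : ℕ → ℝ}
    (hlim : Tendsto (fun n : ℕ => (n : ℝ) * p n - Real.log n) atTop (𝓝 c)) :
    Tendsto (fun m : ℕ => (m : ℝ) * p (m + 1) - Real.log m) atTop (𝓝 c) := by
  have h1 := hlim.comp (tendsto_add_atTop_nat 1)
  have h2 := (tendsto_zero_of_tendsto_mul_sub_log hlim).comp (tendsto_add_atTop_nat 1)
  have h3 := (h1.sub h2).add Real.tendsto_log_nat_add_one_sub_log
  simp only [sub_zero, add_zero] at h3
  refine h3.congr fun m => ?_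
  simp only [Function.comp_apply]
  push_cast
  ring

end Asymptotics

/-- If `n·p_n - log n → c`, then
`limsup P(G_{n,p_n} ∈ D^n) ≤ 1 - exp(-2·exp(-c))·exp(-2c)`. -/
theorem limsup_prob_structurallyDiagonalizable_le (c : ℝ) (p : ℕ → ℝ)
    (hp : ∀ n, p n ∈ Set.Icc (0 : ℝ) 1)
    (hlim : Tendsto (fun n : ℕ => (n : ℝ) * p n - Real.log n) atTop (nhds c)) :
    limsup (fun n : ℕ =>
        digraphProb n (p n) (p n) {E | StructurallyDiagonalizable n E}) atTop
      ≤ 1 - Real.exp (-(2 * Real.exp (-c))) * Real.exp (-(2 * c)) := by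
  have hlim' := tendsto_mul_sub_log_succ hlim
  have hp' : ∀ m, p (m + 1) ∈ Set.Icc (0 : ℝ) 1 := fun m => hp (m + 1)
  have hp0 := tendsto_zero_of_tendsto_mul_sub_log hlim'
  let K : ℕ → ℝ := fun m => m * (m * p (m + 1)) ^ 2 * Real.exp 4 *
    Real.exp (-(5 / 4 * (m * p (m + 1))))
  let g : ℕ → ℝ := fun m => (m * (1 - p (m + 1)) ^ m) ^ 2 * (1 - p (m + 1)) *
    ((1 - (1 - p (m + 1)) ^ m) ^ (2 * m) - 4 * K m)
  have hg : Tendsto g atTop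
      (nhds (Real.exp (-(2 * Real.exp (-c))) * Real.exp (-(2 * c)))) := by
    have h := (((tendsto_natCast_mul_one_sub_pow hp' hlim').pow 2).mul (hp0.const_sub 1)).mul
      ((tendsto_one_sub_one_sub_pow_pow hp' hlim').sub
        ((tendsto_hallObstruction_bound hlim').const_mul 4))
    have hval : Real.exp (-(2 * Real.exp (-c))) * Real.exp (-(2 * c)) =
        Real.exp (-c) ^ 2 * (1 - 0) * (Real.exp (-(2 * Real.exp (-c))) - 4 * 0) := by
      rw [← Real.exp_nat_mul]
      push_cast
      ring_nf
    rw [hval]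
    exact h
  have hle : ∀ᶠ m : ℕ in atTop, digraphProb (m + 1) (p (m + 1)) (p (m + 1))
      {E | StructurallyDiagonalizable (m + 1) E} ≤ 1 - g m := by
    have hsmall := (tendsto_sq_mul_exp_neg_quarter hlim').mul_const (Real.exp 2)
    rw [zero_mul] at hsmall
    filter_upwards [hsmall.eventually_le_const (by norm_num : (0 : ℝ) < 1 / 2)] with m hm
    have hpm := hp' m
    have hq0 : 0 ≤ 1 - p (m + 1) := sub_nonneg.2 hpm.2
    have h1 := bernoulliProb_exists_hallObstruction_le_of_le_half hpm (m := m)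
      (by rwa [mul_right_comm] at hm)
    have h2 := le_bernoulliProb_hasHamiltonianDecomposition hpm m
    have h3 := le_bernoulliProb_not_structurallyDiagonalizable (m := m) hpm
    have h4 := bernoulliProb_nonneg hpm (HasHamiltonianDecomposition m)
    rw [bernoulliProb_not] at h3
    rw [digraphProb_eq_bernoulliProb, le_sub_comm]
    refine le_trans ?_ h3
    calc g m ≤ (m * (1 - p (m + 1)) ^ m) ^ 2 * (1 - p (m + 1)) *
          bernoulliProb (p (m + 1)) (HasHamiltonianDecomposition m) := by
          refine mul_le_mul_of_nonneg_left ?_ (by positivity)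
          change _ - 4 * K m ≤ _
          have : K m = m * (m * p (m + 1)) ^ 2 * Real.exp 4 *
            Real.exp (-(5 / 4 * (m * p (m + 1)))) := rfl
          linarith
      _ = m * m * (1 - p (m + 1)) ^ (2 * m + 1) *
          bernoulliProb (p (m + 1)) (HasHamiltonianDecomposition m) := by ring
      _ ≤ _ := by
          gcongr
          linarith
  rw [← limsup_nat_add _ 1, ← (hg.const_sub 1).limsup_eq]
  refine limsup_le_limsup hle (IsBoundedUnder.isCoboundedUnder_le ?_)
    (hg.const_sub 1).isBoundedUnder_le
  exact isBoundedUnder_of ⟨0, fun m => by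
    rw [digraphProb_eq_bernoulliProb]
    exact bernoulliProb_nonneg (hp' m) _⟩
end

section
/- A digraph G on n labeled vertices that contains an isolated edge is not structurally diagonalizable. -/
open Finset Filter

/-- An isolated edge: an edge `(u, v)` with `u ≠ v` which is the only edge of the
digraph incident to `u` and the only edge incident to `v`. -/
def IsIsolatedEdge (n : ℕ) (E : Finset (Fin n × Fin n)) (u v : Fin n) : Prop :=
  u ≠ v ∧ (u, v) ∈ E ∧
    ∀ e ∈ E, (e.1 = u ∨ e.2 = u ∨ e.1 = v ∨ e.2 = v) → e = (u, v)

/-- Inserting an isolated edge of `E` into a matching contained in `E` gives a matching. -/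
theorem IsMatching.insert_isolatedEdge {n : ℕ} {E M : Finset (Fin n × Fin n)} {u v : Fin n}
    (hM : IsMatching n M) (hME : M ⊆ E) (h : IsIsolatedEdge n E u v) :
    IsMatching n (insert (u, v) M) := by
  obtain ⟨-, -, hiso⟩ := h
  intro e he f hf hef
  rcases Finset.mem_insert.1 he with rfl | he <;> rcases Finset.mem_insert.1 hf with rfl | hf
  · rfl
  · exact (hiso f (hME hf) (by tauto)).symm
  · exact hiso e (hME he) (by tauto)
  · exact hM e he f hf hef

/-- A maximum matching contains every isolated edge. -/
theorem IsMaxMatching.isolatedEdge_mem {n : ℕ} {E M : Finset (Fin n × Fin n)} {u v : Fin n}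
    (hM : IsMaxMatching n E M) (h : IsIsolatedEdge n E u v) : (u, v) ∈ M := by
  obtain ⟨hME, hmatch, hmax⟩ := hM
  by_contra hmem
  have hcard := hmax _ (Finset.insert_subset h.2.1 hME) (hmatch.insert_isolatedEdge hME h)
  rw [Finset.card_insert_of_notMem hmem] at hcard
  omega

/-- A digraph containing an isolated edge is not structurally
diagonalizable. -/
theorem isolatedEdge_not_structurallyDiagonalizable
    (n : ℕ) (E : Finset (Fin n × Fin n)) (u v : Fin n)
    (h : IsIsolatedEdge n E u v) :
    ¬ StructurallyDiagonalizable n E := by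
  rintro ⟨M, hM, σ, S, hS, hMS⟩
  have huv := hM.isolatedEdge_mem h
  rw [hMS] at huv
  obtain ⟨w, hw, hwuv⟩ := Finset.mem_image.1 huv
  obtain ⟨-, hσ⟩ := Prod.mk.inj hwuv
  have hv : v ∈ S := hσ ▸ hS w hw
  have hvM : (v, σ v) ∈ M := hMS ▸ Finset.mem_image_of_mem (fun u => (u, σ u)) hv
  have heq := h.2.2 _ (hM.1 hvM) (by simp)
  exact h.1 (congrArg Prod.fst heq).symm
end

section
/- Let c > 0 be a constant and set p_n = c/n. Then the probability that a digraph drawn from the random digraph model G(n, p_n) is structurally diagonalizable tends to 0 as n → ∞. -/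
open Finset Filter

/-- A vertex `b` without out-edges that is the only out-neighbour of some vertex `a` obstructs
structural diagonalizability: every maximum matching has to cover the right copy of `b`. -/
theorem StructurallyDiagonalizable.exists_mem_of_forall_mem_iff {n : ℕ}
    {E : Finset (Fin n × Fin n)} (h : StructurallyDiagonalizable n E) {a b : Fin n}
    (ha : ∀ v, (a, v) ∈ E ↔ v = b) : ∃ v, (b, v) ∈ E := by
  obtain ⟨M, ⟨hME, hM, hmax⟩, σ, S, hS, hMS⟩ := h
  by_cases hw : ∃ w, (w, b) ∈ M
  · obtain ⟨w, hw⟩ := hw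
    rw [hMS, mem_image] at hw
    obtain ⟨u, hu, huw⟩ := hw
    have hb : b ∈ S := by
      obtain rfl : σ u = b := congrArg Prod.snd huw
      exact hS u hu
    refine ⟨σ b, hME ?_⟩
    rw [hMS]
    exact mem_image_of_mem _ hb
  · push Not at hw
    have hsub : insert (a, b) M ⊆ E := insert_subset ((ha b).2 rfl) hME
    have hnew : ∀ e ∈ M, ¬(e.1 = a ∨ e.2 = b) := by
      rintro ⟨u, v⟩ he (rfl | rfl)
      · obtain rfl := (ha v).1 (hME he)
        exact hw _ he
      · exact hw _ he
    have hmatch : IsMatching n (insert (a, b) M) := by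
      intro e he f hf hef
      rcases mem_insert.1 he with rfl | he <;> rcases mem_insert.1 hf with rfl | hf
      · rfl
      · exact absurd (hef.imp Eq.symm Eq.symm) (hnew f hf)
      · exact absurd hef (hnew e he)
      · exact hM e he f hf hef
    have hcard := hmax _ hsub hmatch
    rw [card_insert_of_notMem (hw a)] at hcard
    omega

/-- The equivalence between sets of edges and families of out-neighbourhoods. -/
def edgesEquivRows (α : Type*) [Fintype α] [DecidableEq α] :
    Finset (α × α) ≃ (α → Finset α) where
  toFun E a := univ.filter fun b => (a, b) ∈ E
  invFun f := univ.filter fun e => e.2 ∈ f e.1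
  left_inv E := by ext; simp
  right_inv f := by ext; simp

@[simp]
theorem mem_edgesEquivRows {α : Type*} [Fintype α] [DecidableEq α] {E : Finset (α × α)} {a b : α} :
    b ∈ edgesEquivRows α E a ↔ (a, b) ∈ E := by
  simp [edgesEquivRows]

/-- The probability that a random subset of `α`, containing each element independently with
probability `p`, equals `R`. -/
def subsetWeight {α : Type*} [Fintype α] [DecidableEq α] (p : ℝ) (R : Finset α) : ℝ :=
  ∏ b, if b ∈ R then p else 1 - p

section subsetWeight

variable {α : Type*} [Fintype α] [DecidableEq α] {p : ℝ}

theorem subsetWeight_eq (p : ℝ) (R : Finset α) :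
    subsetWeight p R = p ^ #R * (1 - p) ^ (Fintype.card α - #R) := by
  rw [subsetWeight, prod_ite]
  simp [filter_not, ← compl_eq_univ_sdiff, card_compl]

theorem subsetWeight_nonneg (h0 : 0 ≤ p) (h1 : p ≤ 1) (R : Finset α) : 0 ≤ subsetWeight p R :=
  prod_nonneg fun b _ => by split_ifs <;> linarith

theorem sum_subsetWeight (p : ℝ) : ∑ R : Finset α, subsetWeight p R = 1 := by
  simp_rw [subsetWeight_eq]
  rw [Fintype.sum_pow_mul_eq_add_pow]
  simp

theorem subsetWeight_empty (p : ℝ) :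
    subsetWeight p (∅ : Finset α) = (1 - p) ^ Fintype.card α := by
  simp [subsetWeight_eq]

theorem subsetWeight_singleton (p : ℝ) (b : α) :
    subsetWeight p {b} = p * (1 - p) ^ (Fintype.card α - 1) := by
  simp [subsetWeight_eq]

theorem sum_compl_singletons_subsetWeight (p : ℝ) (Z : Finset α) :
    ∑ R ∈ (Z.image fun b => ({b} : Finset α))ᶜ, subsetWeight p R =
      1 - #Z * (p * (1 - p) ^ (Fintype.card α - 1)) := by
  have h := sum_add_sum_compl (Z.image fun b => ({b} : Finset α)) (subsetWeight p)
  rw [sum_subsetWeight, sum_image singleton_injective.injOn] at h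
  simp only [subsetWeight_singleton, sum_const, nsmul_eq_mul] at h
  exact eq_sub_of_add_eq' h

/-- In a family of independent random subsets indexed by `α`, the probability that no singleton
`{b}` in the family has an empty set at the index `b` is exponentially small. -/
theorem sum_prod_subsetWeight_le (h0 : 0 ≤ p) (h1 : p ≤ 1) (A : Finset α)
    (Q : (α → Finset α) → Prop) [DecidablePred Q]
    (hQ : ∀ f, Q f → ∀ a b, f a = {b} → f b ≠ ∅) :
    ∑ f with Q f, ∏ a, subsetWeight p (f a) ≤
      (1 - (1 - p) ^ Fintype.card α *
        (1 - Real.exp (-(p * (1 - p) ^ (Fintype.card α - 1) * #A)))) ^ #Aᶜ := by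
  set q := (1 - p) ^ Fintype.card α
  set s := p * (1 - p) ^ (Fintype.card α - 1) with hs
  have hq0 : 0 ≤ q := pow_nonneg (by linarith) _
  have hq1 : q ≤ 1 := pow_le_one₀ (by linarith) (by linarith)
  let t : Finset α → α → Finset (Finset α) := fun Z i =>
    if i ∈ A then (Z.image fun b => ({b} : Finset α))ᶜ else if i ∈ Z then {∅} else {∅}ᶜ
  have hprod : ∀ Z ∈ Aᶜ.powerset, ∏ i, ∑ R ∈ t Z i, subsetWeight p R =
      (1 - #Z * s) ^ #A * (q ^ #Z * (1 - q) ^ (#Aᶜ - #Z)) := by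
    intro Z hZ
    rw [mem_powerset] at hZ
    have hsum : ∀ i, ∑ R ∈ t Z i, subsetWeight p R =
        if i ∈ A then 1 - #Z * s else if i ∈ Z then q else 1 - q := by
      intro i
      simp only [t]
      split_ifs
      · exact sum_compl_singletons_subsetWeight p Z
      · rw [sum_singleton, subsetWeight_empty]
      · rw [eq_sub_iff_add_eq', ← sum_subsetWeight (α := α) p, ← sum_add_sum_compl {∅},
          sum_singleton, subsetWeight_empty]
    simp_rw [hsum]
    rw [← prod_mul_prod_compl A, prod_congr rfl fun i hi => if_pos hi,
      prod_congr rfl fun i hi => if_neg (mem_compl.1 hi), prod_ite, prod_const, prod_const,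
      prod_const, filter_mem_eq_inter, inter_eq_right.2 hZ, filter_notMem_eq_sdiff,
      card_sdiff_of_subset hZ]
  calc ∑ f with Q f, ∏ a, subsetWeight p (f a)
      = ∑ Z ∈ Aᶜ.powerset, ∑ f ∈ univ.filter Q with {b ∈ Aᶜ | f b = ∅} = Z,
          ∏ a, subsetWeight p (f a) :=
        (sum_fiberwise_of_maps_to (fun f _ => mem_powerset.2 (filter_subset _ _)) _).symm
    _ ≤ ∑ Z ∈ Aᶜ.powerset, ∑ f ∈ Fintype.piFinset (t Z), ∏ a, subsetWeight p (f a) := by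
        refine sum_le_sum fun Z _ => sum_le_sum_of_subset_of_nonneg ?_ fun f _ _ =>
          prod_nonneg fun a _ => subsetWeight_nonneg h0 h1 _
        intro f hf
        obtain ⟨hfu, rfl⟩ := mem_filter.1 hf
        have hfQ := hQ f (mem_filter.1 hfu).2
        rw [Fintype.mem_piFinset]
        intro i
        simp only [t]
        split_ifs with hi hiZ
        · simp only [mem_compl, mem_image, mem_filter, not_exists, not_and]
          rintro b ⟨-, hb⟩ hib
          exact hfQ i b hib.symm hb
        · exact mem_singleton.2 (mem_filter.1 hiZ).2
        · simpa [hi] using hiZ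
    _ = ∑ Z ∈ Aᶜ.powerset, (1 - #Z * s) ^ #A * (q ^ #Z * (1 - q) ^ (#Aᶜ - #Z)) :=
        sum_congr rfl fun Z hZ => by rw [← prod_univ_sum, hprod Z hZ]
    _ ≤ ∑ Z ∈ Aᶜ.powerset,
          (q * Real.exp (-(s * #A))) ^ #Z * (1 - q) ^ (#Aᶜ - #Z) := by
        refine sum_le_sum fun Z _ => ?_
        have hZ0 : 0 ≤ 1 - #Z * s := by
          rw [hs, ← sum_compl_singletons_subsetWeight]
          exact sum_nonneg fun R _ => subsetWeight_nonneg h0 h1 R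
        have hexp : (1 - #Z * s) ^ #A ≤ Real.exp (-(s * #A)) ^ #Z := by
          calc (1 - #Z * s) ^ #A ≤ Real.exp (-(#Z * s)) ^ #A :=
                pow_le_pow_left₀ hZ0 (Real.one_sub_le_exp_neg _) _
            _ = Real.exp (-(s * #A)) ^ #Z := by
                rw [← Real.exp_nat_mul, ← Real.exp_nat_mul]
                ring_nf
        have hq' : 0 ≤ q ^ #Z * (1 - q) ^ (#Aᶜ - #Z) :=
          mul_nonneg (pow_nonneg hq0 _) (pow_nonneg (by linarith) _)
        calc _ ≤ _ := mul_le_mul_of_nonneg_right hexp hq'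
          _ = _ := by rw [mul_pow]; ring
    _ = _ := by
        rw [sum_pow_mul_eq_add_pow]
        ring_nf

end subsetWeight

theorem digraphProb_self_eq_sum_rows (n : ℕ) (p : ℝ) (A : Set (Finset (Fin n × Fin n)))
    [DecidablePred (· ∈ A)] :
    digraphProb n p p A =
      ∑ f with (edgesEquivRows (Fin n)).symm f ∈ A, ∏ a, subsetWeight p (f a) := by
  rw [digraphProb, sum_filter]
  refine Fintype.sum_equiv (edgesEquivRows (Fin n)) _ _ fun E => ?_
  simp only [Set.indicator_apply, Equiv.symm_apply_apply, ite_self, subsetWeight,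
    mem_edgesEquivRows]
  refine if_congr Iff.rfl ?_ rfl
  rw [← Fintype.prod_prod_type' fun a b => if (a, b) ∈ E then p else 1 - p, prod_ite]
  simp [filter_notMem_eq_sdiff]

theorem digraphProb_nonneg {n : ℕ} {p : ℝ} (h0 : 0 ≤ p) (h1 : p ≤ 1)
    (A : Set (Finset (Fin n × Fin n))) : 0 ≤ digraphProb n p p A := by
  classical
  rw [digraphProb_self_eq_sum_rows]
  exact sum_nonneg fun f _ => prod_nonneg fun a _ => subsetWeight_nonneg h0 h1 _

theorem digraphProb_structurallyDiagonalizable_le {n : ℕ} {p : ℝ} (h0 : 0 ≤ p) (h1 : p ≤ 1) :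
    digraphProb n p p {E | StructurallyDiagonalizable n E} ≤
      (1 - (1 - p) ^ n *
        (1 - Real.exp (-(p * (1 - p) ^ (n - 1) * (n / 2 : ℕ))))) ^ (n - n / 2) := by
  classical
  obtain ⟨A, -, hA⟩ := exists_subset_card_eq (s := (univ : Finset (Fin n))) (n := n / 2)
    (by simpa using Nat.div_le_self n 2)
  rw [digraphProb_self_eq_sum_rows]
  have key := sum_prod_subsetWeight_le h0 h1 A
    (fun f => (edgesEquivRows (Fin n)).symm f ∈ {E | StructurallyDiagonalizable n E})
    (by
      intro f hf a b hab hb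
      obtain ⟨E, rfl⟩ := (edgesEquivRows (Fin n)).surjective f
      rw [Equiv.symm_apply_apply] at hf
      obtain ⟨v, hv⟩ := StructurallyDiagonalizable.exists_mem_of_forall_mem_iff hf (a := a)
        (b := b) fun v => by rw [← mem_edgesEquivRows, hab, mem_singleton]
      rw [← mem_edgesEquivRows, hb] at hv
      exact notMem_empty v hv)
  simpa [card_compl, hA] using key

/-- With `p_n = c/n` for a positive constant `c`, the probability
that a digraph from `G(n, p_n)` is structurally diagonalizable tends to `0`. -/
theorem prob_structurallyDiagonalizable_sparse_tendsto_zero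
    (c : ℝ) (hc : 0 < c) :
    Tendsto (fun n : ℕ =>
        digraphProb n (c / n) (c / n) {E | StructurallyDiagonalizable n E}) atTop
      (nhds 0) := by
  set d : ℝ := Real.exp (-c) / 2 with hd
  have hd0 : 0 < d := by positivity
  have hd1 : d < 1 := by
    have : Real.exp (-c) ≤ 1 := Real.exp_le_one_iff.2 (by linarith)
    linarith
  set r : ℝ := 1 - d * (1 - Real.exp (-(c * d / 4))) with hr
  have hexp : Real.exp (-(c * d / 4)) < 1 := Real.exp_lt_one_iff.2 (by
    have : 0 < c * d := mul_pos hc hd0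
    linarith)
  have hr0 : 0 ≤ r := by nlinarith [Real.exp_pos (-(c * d / 4))]
  have hr1 : r < 1 := by nlinarith
  have hlim : Tendsto (fun n : ℕ => r ^ (n - n / 2)) atTop (nhds 0) :=
    (tendsto_pow_atTop_nhds_zero_of_lt_one hr0 hr1).comp
      (tendsto_atTop_mono (fun n => by omega) (Nat.tendsto_div_const_atTop two_ne_zero))
  have hq : ∀ᶠ n : ℕ in atTop, d < (1 - c / n) ^ n := by
    have := Real.tendsto_one_add_div_pow_exp (-c)
    filter_upwards [this.eventually_const_lt (half_lt_self (Real.exp_pos (-c)))] with n hn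
    simpa [neg_div, ← sub_eq_add_neg] using hn
  have hn : ∀ᶠ n : ℕ in atTop, c ≤ n ∧ 2 ≤ n :=
    (tendsto_natCast_atTop_atTop.eventually_ge_atTop c).and (eventually_ge_atTop 2)
  refine tendsto_of_tendsto_of_tendsto_of_le_of_le' tendsto_const_nhds hlim ?_ ?_
  · filter_upwards [hn] with n hn
    exact digraphProb_nonneg (by positivity) (div_le_one_of_le₀ hn.1 (by positivity)) _
  · filter_upwards [hn, hq] with n ⟨hcn, hn2⟩ hq
    have hn0 : (0 : ℝ) < n := by positivity
    have h0 : 0 ≤ c / n := by positivity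
    have h1 : c / n ≤ 1 := div_le_one_of_le₀ hcn hn0.le
    refine (digraphProb_structurallyDiagonalizable_le h0 h1).trans ?_
    have hhalf : (n : ℝ) / 4 ≤ (n / 2 : ℕ) := by
      rw [div_le_iff₀ (by norm_num)]
      exact_mod_cast (by omega : n ≤ n / 2 * 4)
    have hpow : d ≤ (1 - c / n) ^ (n - 1) :=
      hq.le.trans (pow_le_pow_of_le_one (by linarith) (by linarith) (Nat.sub_le n 1))
    have hs : c * d / 4 ≤ c / n * (1 - c / n) ^ (n - 1) * (n / 2 : ℕ) := by
      calc c * d / 4 = c / n * d * (n / 4) := by field_simp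
        _ ≤ _ := by gcongr
    have hq1 : (1 - c / n) ^ n ≤ 1 := pow_le_one₀ (by linarith) (by linarith)
    have he : Real.exp (-(c / n * (1 - c / n) ^ (n - 1) * (n / 2 : ℕ))) ≤
        Real.exp (-(c * d / 4)) := Real.exp_le_exp.2 (neg_le_neg hs)
    refine pow_le_pow_left₀ ?_ ?_ _
    · nlinarith [Real.exp_pos (-(c / n * (1 - c / n) ^ (n - 1) * (n / 2 : ℕ)))]
    · have := mul_le_mul hq.le (sub_le_sub_left he 1) (by linarith) (by linarith)
      linarith
end
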